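/- Let w be a positive superharmonic function on 𝔻, and let Λ : 𝒟_w → ℂ be a linear functional (no continuity assumed) such that Λ(1) = 1 and Λ(g) ≠ 0 for every g ∈ 𝒟_w that vanishes nowhere on 𝔻. Then there exists a point a ∈ 𝔻 such that Λ(f) = f(a) for all f ∈ 𝒟_w. -/

import Mathlib

open Complex MeasureTheory Metric Set

/-- `w : ℂ → ℝ` is superharmonic on the open unit disk: it is lower
semicontinuous there and satisfies the super-mean-value inequality on every
closed disk contained in `𝔻`. -/
def SuperharmonicOnDisk (w : ℂ → ℝ) : Prop :=
  LowerSemicontinuousOn w (Metric.ball 0 1) ∧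
    ∀ z₀ ∈ Metric.ball (0 : ℂ) 1, ∀ r > (0 : ℝ),
      Metric.closedBall z₀ r ⊆ Metric.ball 0 1 →
      (1 / (2 * Real.pi)) * ∫ θ in (0 : ℝ)..(2 * Real.pi),
          w (z₀ + r * Complex.exp (θ * Complex.I)) ≤ w z₀

/-- Membership in the weighted Dirichlet space `𝒟_w`: `f` is holomorphic on the
open unit disk and `(1/π)∫_𝔻 |f′|² w dA < ∞` (equivalently, `|f′|² w` is
integrable on the disk). -/
def MemDirichletW (w : ℂ → ℝ) (f : ℂ → ℂ) : Prop :=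
  DifferentiableOn ℂ f (Metric.ball 0 1) ∧
    MeasureTheory.IntegrableOn (fun z => ‖deriv f z‖ ^ 2 * w z) (Metric.ball 0 1)

lemma Multiset.sum_map_sq_add_two_mul_esymm_two (s : Multiset ℂ) :
    (s.map (fun a => a ^ 2)).sum + 2 * s.esymm 2 = s.sum ^ 2 := by
  induction s using Multiset.induction_on with
  | empty => simp [Multiset.esymm, Multiset.powersetCard_zero_right]
  | cons a s ih =>
    have h : (a ::ₘ s).esymm 2 = s.esymm 2 + a * s.sum := by
      have := Multiset.sum_map_mul_left (s := s) (a := a) (f := fun x => x)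
      simp only [Multiset.map_id'] at this
      simp [Multiset.esymm, Multiset.powersetCard_cons, Multiset.powersetCard_one,
        Multiset.map_map, this]
    rw [h, Multiset.map_cons, Multiset.sum_cons, Multiset.sum_cons]
    linear_combination ih

open Polynomial in
lemma LinearMap.exists_monic_eval_eq_map_pow {A : Type*} [CommRing A] [Algebra ℂ A]
    (φ : A →ₗ[ℂ] ℂ) (h1 : φ 1 = 1) (x : A) (n : ℕ) :
    ∃ P : ℂ[X], P.Monic ∧ P.natDegree = n + 2 ∧
      (∀ l, P.eval l = φ ((algebraMap ℂ A l - x) ^ (n + 2))) ∧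
      P.coeff (n + 1) = -((n + 2) * φ x) ∧
      P.coeff n = ((n + 2) * (n + 1) / 2) * φ (x ^ 2) := by
  let P : ℂ[X] := ∑ k ∈ Finset.range (n + 3),
    C (((-1) ^ (n + 2 - k) * ((n + 2).choose k : ℂ)) * φ (x ^ (n + 2 - k))) * X ^ k
  have hc : ∀ k, k < n + 3 → P.coeff k =
      ((-1) ^ (n + 2 - k) * ((n + 2).choose k : ℂ)) * φ (x ^ (n + 2 - k)) := by
    intro k hk
    simp only [P, finsetSum_coeff, coeff_C_mul, coeff_X_pow]
    simp [hk]
  have htop : P.coeff (n + 2) = 1 := by rw [hc _ (by omega)]; simp [h1]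
  have hdeg : P.natDegree ≤ n + 2 := by
    refine natDegree_sum_le_of_forall_le _ _ fun k hk => ?_
    exact (natDegree_C_mul_X_pow_le _ _).trans (by simp at hk; omega)
  refine ⟨P, monic_of_natDegree_le_of_coeff_eq_one _ hdeg htop,
    natDegree_eq_of_le_of_coeff_ne_zero hdeg (by simp [htop]), ?_, ?_, ?_⟩
  · intro l
    rw [sub_eq_add_neg, add_pow, map_sum, eval_finsetSum]
    refine Finset.sum_congr rfl fun k _ => ?_
    have : (algebraMap ℂ A l) ^ k * (-x) ^ (n + 2 - k) * ((n + 2).choose k : A) =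
        (l ^ k * ((-1) ^ (n + 2 - k) * ((n + 2).choose k : ℂ))) • x ^ (n + 2 - k) := by
      rw [Algebra.smul_def, neg_pow x]; simp; ring
    rw [this, map_smul]; simp; ring
  · rw [hc _ (by omega)]
    have : n + 2 - (n + 1) = 1 := by omega
    rw [this, Nat.choose_succ_self_right]; push_cast; simp; ring
  · rw [hc _ (by omega)]
    have : n + 2 - n = 2 := by omega
    rw [this, Nat.choose_symm_add, Nat.cast_choose_two]; push_cast; ring

/-- A unital functional that is bounded on the roots of all `l ↦ φ ((l - x) ^ n)` respects the
square of `x`. -/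
lemma LinearMap.map_sq_of_roots_bounded {A : Type*} [CommRing A] [Algebra ℂ A]
    (φ : A →ₗ[ℂ] ℂ) (h1 : φ 1 = 1) (x : A) (M : ℝ)
    (h : ∀ (n : ℕ) (l : ℂ), φ ((algebraMap ℂ A l - x) ^ n) = 0 → ‖l‖ ≤ M) :
    φ (x ^ 2) = φ x ^ 2 := by
  have key : ∀ n : ℕ, ‖((n : ℂ) + 2) * φ x ^ 2 - (n + 1) * φ (x ^ 2)‖ ≤ M ^ 2 := by
    intro n
    obtain ⟨P, hm, hd, he, hc1, hc2⟩ := φ.exists_monic_eval_eq_map_pow h1 x n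
    have hcard : P.roots.card = P.natDegree :=
      (IsAlgClosed.splits P).natDegree_eq_card_roots.symm
    have e1 := Polynomial.coeff_eq_esymm_roots_of_card hcard (k := n + 1) (by omega)
    have e2 := Polynomial.coeff_eq_esymm_roots_of_card hcard (k := n) (by omega)
    rw [hm.leadingCoeff, hd, hc1] at e1
    rw [hm.leadingCoeff, hd, hc2] at e2
    have i1 : n + 2 - (n + 1) = 1 := by omega
    have i2 : n + 2 - n = 2 := by omega
    have i3 : P.roots.esymm 1 = P.roots.sum := by
      simp [Multiset.esymm, Multiset.powersetCard_one, Multiset.map_map]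
    rw [i1, i3] at e1
    rw [i2] at e2
    have hs := Multiset.sum_map_sq_add_two_mul_esymm_two P.roots
    have hb : ‖(P.roots.map (fun a => a ^ 2)).sum‖ ≤ (n + 2) * M ^ 2 := by
      refine (norm_multiset_sum_le _).trans ?_
      rw [Multiset.map_map]
      have := Multiset.sum_le_card_nsmul (P.roots.map (fun a => ‖a ^ 2‖)) (M ^ 2) ?_
      · rw [Multiset.card_map, hcard, hd, nsmul_eq_mul] at this
        push_cast at this
        exact this
      · intro y hy
        obtain ⟨a, ha, rfl⟩ := Multiset.mem_map.1 hy
        rw [norm_pow]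
        have := h (n + 2) a (by rw [← he]; exact (Polynomial.mem_roots'.1 ha).2)
        gcongr
    have hn : ‖(n : ℂ) + 2‖ = n + 2 := by
      have : (n : ℂ) + 2 = ((n + 2 : ℕ) : ℂ) := by push_cast; ring
      rw [this, Complex.norm_natCast]; push_cast; ring
    have : (P.roots.map (fun a => a ^ 2)).sum =
        ((n : ℂ) + 2) * (((n : ℂ) + 2) * φ x ^ 2 - (n + 1) * φ (x ^ 2)) := by
      linear_combination hs + 2 * e2 + (P.roots.sum + (n + 2) * φ x) * e1
    rw [this, norm_mul, hn] at hb
    exact le_of_mul_le_mul_left hb (by positivity)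
  by_contra hne
  have hpos : 0 < ‖φ x ^ 2 - φ (x ^ 2)‖ := norm_pos_iff.2 (sub_ne_zero.2 (Ne.symm hne))
  obtain ⟨n, hn⟩ := exists_nat_gt ((M ^ 2 + ‖φ x ^ 2‖) / ‖φ x ^ 2 - φ (x ^ 2)‖)
  rw [div_lt_iff₀ hpos] at hn
  have h2 : ‖((n : ℂ) + 1) * (φ x ^ 2 - φ (x ^ 2))‖ ≤ M ^ 2 + ‖φ x ^ 2‖ := by
    have e : ((n : ℂ) + 1) * (φ x ^ 2 - φ (x ^ 2)) =
      (((n : ℂ) + 2) * φ x ^ 2 - (n + 1) * φ (x ^ 2)) - φ x ^ 2 := by ring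
    rw [e]
    exact (norm_sub_le _ _).trans (by gcongr; exact key n)
  have h3 : ‖(n : ℂ) + 1‖ = n + 1 := by
    have : (n : ℂ) + 1 = ((n + 1 : ℕ) : ℂ) := by push_cast; ring
    rw [this, Complex.norm_natCast]; push_cast; ring
  rw [norm_mul, h3] at h2
  nlinarith

lemma LinearMap.map_mul_of_map_sq {A : Type*} [CommRing A] [Algebra ℂ A]
    (φ : A →ₗ[ℂ] ℂ) (h : ∀ x, φ (x ^ 2) = φ x ^ 2) (x y : A) : φ (x * y) = φ x * φ y := by
  have e : (x + y) ^ 2 = x ^ 2 + (2 : ℂ) • (x * y) + y ^ 2 := by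
    rw [Algebra.smul_def, map_ofNat]; ring
  have := h (x + y)
  rw [e] at this
  simp only [map_add, map_smul, h, smul_eq_mul] at this
  linear_combination this / 2

/-- The hypotheses on the functional in the Gleason–Kahane–Żelazko theorem. -/
structure IsNonvanishingFunctional (w : ℂ → ℝ) (Λ : (ℂ → ℂ) → ℂ) : Prop where
  add : ∀ f g, MemDirichletW w f → MemDirichletW w g → Λ (f + g) = Λ f + Λ g
  smul : ∀ (c : ℂ) (f), MemDirichletW w f → Λ (c • f) = c * Λ f
  congr : ∀ f g, MemDirichletW w f → MemDirichletW w g →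
      Set.EqOn f g (Metric.ball 0 1) → Λ f = Λ g
  one : Λ 1 = 1
  ne_zero : ∀ g, MemDirichletW w g → (∀ z ∈ Metric.ball (0 : ℂ) 1, g z ≠ 0) → Λ g ≠ 0

namespace MemDirichletW

variable {w : ℂ → ℝ} {f g h : ℂ → ℂ}

lemma differentiableAt (hf : MemDirichletW w f) {z : ℂ} (hz : z ∈ ball (0 : ℂ) 1) :
    DifferentiableAt ℂ f z := hf.1.differentiableAt (isOpen_ball.mem_nhds hz)

lemma const (c : ℂ) : MemDirichletW w (fun _ => c) :=
  ⟨differentiableOn_const c, by simp⟩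

lemma of_norm_deriv_le (hw : ∀ z ∈ ball (0 : ℂ) 1, 0 < w z) (hwi : IntegrableOn w (ball 0 1))
    {C : ℝ} (hf : DifferentiableOn ℂ f (ball 0 1)) (hg : MemDirichletW w g)
    (hh : MemDirichletW w h)
    (hb : ∀ z ∈ ball (0 : ℂ) 1, ‖deriv f z‖ ≤ C * (‖deriv g z‖ + ‖deriv h z‖ + 1)) :
    MemDirichletW w f := by
  refine ⟨hf, ?_⟩
  refine Integrable.mono' (((hg.2.add hh.2).add hwi).const_mul (3 * C ^ 2)) ?_ ?_
  · exact ((measurable_deriv f).norm.pow_const 2).aestronglyMeasurable.mul hwi.1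
  · refine (ae_restrict_iff' measurableSet_ball).2 (Filter.Eventually.of_forall fun z hz => ?_)
    have hwz := hw z hz
    have h1 := hb z hz
    rw [Real.norm_of_nonneg (by positivity)]
    simp only [Pi.add_apply]
    have h2 : ‖deriv f z‖ ^ 2 ≤ 3 * C ^ 2 * (‖deriv g z‖ ^ 2 + ‖deriv h z‖ ^ 2 + 1) := by
      calc ‖deriv f z‖ ^ 2 ≤ (C * (‖deriv g z‖ + ‖deriv h z‖ + 1)) ^ 2 := by gcongr
        _ = C ^ 2 * (‖deriv g z‖ + ‖deriv h z‖ + 1) ^ 2 := by ring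
        _ ≤ C ^ 2 * (3 * (‖deriv g z‖ ^ 2 + ‖deriv h z‖ ^ 2 + 1)) := by
          gcongr
          nlinarith [sq_nonneg (‖deriv g z‖ - ‖deriv h z‖), sq_nonneg (‖deriv g z‖ - 1),
            sq_nonneg (‖deriv h z‖ - 1)]
        _ = _ := by ring
    calc ‖deriv f z‖ ^ 2 * w z
        ≤ 3 * C ^ 2 * (‖deriv g z‖ ^ 2 + ‖deriv h z‖ ^ 2 + 1) * w z := by gcongr
      _ = _ := by ring

variable (hw : ∀ z ∈ ball (0 : ℂ) 1, 0 < w z) (hwi : IntegrableOn w (ball 0 1))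
include hw hwi

lemma id : MemDirichletW w (fun z => z) :=
  of_norm_deriv_le (C := 1) hw hwi differentiableOn_id (const 0) (const 0) (by simp)

lemma add (hf : MemDirichletW w f) (hg : MemDirichletW w g) : MemDirichletW w (f + g) := by
  refine of_norm_deriv_le (C := 1) hw hwi (hf.1.add hg.1) hf hg fun z hz => ?_
  rw [deriv_add (hf.differentiableAt hz) (hg.differentiableAt hz)]
  linarith [norm_add_le (deriv f z) (deriv g z)]

lemma const_smul (c : ℂ) (hf : MemDirichletW w f) : MemDirichletW w (c • f) := by
  refine of_norm_deriv_le (C := ‖c‖) hw hwi (hf.1.const_smul c) hf hf fun z hz => ?_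
  rw [deriv_const_smul _ (hf.differentiableAt hz), norm_smul]
  gcongr
  linarith [norm_nonneg (deriv f z)]

lemma sub_const (c : ℂ) (hf : MemDirichletW w f) : MemDirichletW w (fun z => f z - c) := by
  simpa [sub_eq_add_neg, Pi.add_def] using hf.add hw hwi (const (-c))

lemma mul (hf : MemDirichletW w f) (hg : MemDirichletW w g) {M : ℝ}
    (hfM : ∀ z ∈ ball (0 : ℂ) 1, ‖f z‖ ≤ M) (hgM : ∀ z ∈ ball (0 : ℂ) 1, ‖g z‖ ≤ M) :
    MemDirichletW w (f * g) := by
  refine of_norm_deriv_le (C := M) hw hwi (hf.1.mul hg.1) hf hg fun z hz => ?_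
  rw [deriv_mul (hf.differentiableAt hz) (hg.differentiableAt hz)]
  have h1 := hfM z hz
  have h2 := hgM z hz
  have hM : 0 ≤ M := (norm_nonneg _).trans h1
  calc ‖deriv f z * g z + f z * deriv g z‖ ≤ ‖deriv f z‖ * ‖g z‖ + ‖f z‖ * ‖deriv g z‖ := by
        simpa using norm_add_le (deriv f z * g z) (f z * deriv g z)
    _ ≤ ‖deriv f z‖ * M + M * ‖deriv g z‖ := by gcongr
    _ ≤ _ := by linarith

lemma exists_eqOn_sub_mul (hf : MemDirichletW w f) {M : ℝ}
    (hM : ∀ z ∈ ball (0 : ℂ) 1, ‖f z‖ ≤ M) {a : ℂ} (ha : a ∈ ball (0 : ℂ) 1) :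
    ∃ q, MemDirichletW w q ∧ (∃ B, ∀ z ∈ ball (0 : ℂ) 1, ‖q z‖ ≤ B) ∧
      ∀ z, f z = f a + (z - a) * q z := by
  have hfa := hf.differentiableAt ha
  have hd : DifferentiableOn ℂ (dslope f a) (ball 0 1) :=
    (differentiableOn_dslope (isOpen_ball.mem_nhds ha)).2 hf.1
  have hM0 : 0 ≤ M := (norm_nonneg _).trans (hM a ha)
  obtain ⟨δ, hδ, hsub⟩ := Metric.nhds_basis_closedBall.mem_iff.1 (isOpen_ball.mem_nhds ha)
  have hcomp := isCompact_closedBall a δ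
  obtain ⟨B1, hB1⟩ := hcomp.exists_bound_of_continuousOn (hd.continuousOn.mono hsub)
  obtain ⟨B2, hB2⟩ := hcomp.exists_bound_of_continuousOn
    ((hd.deriv isOpen_ball).continuousOn.mono hsub)
  have heq : ∀ z, f z = f a + (z - a) * dslope f a z := by
    intro z
    have := sub_smul_dslope f a z
    rw [smul_eq_mul] at this
    rw [this]; ring
  have hout : ∀ z ∈ ball (0 : ℂ) 1, z ∉ closedBall a δ → ‖dslope f a z‖ ≤ 2 * M / δ := by
    intro z hz hza
    have hza' : δ < ‖z - a‖ := by simpa [mem_closedBall, dist_eq_norm] using hza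
    have h1 : ‖z - a‖ * ‖dslope f a z‖ ≤ 2 * M := by
      rw [← norm_mul]
      have : (z - a) * dslope f a z = f z - f a := by rw [heq z]; ring
      rw [this]
      linarith [norm_sub_le (f z) (f a), hM z hz, hM a ha]
    rw [le_div_iff₀ hδ]
    nlinarith [norm_nonneg (dslope f a z)]
  have hB : ∀ z ∈ ball (0 : ℂ) 1, ‖dslope f a z‖ ≤ max B1 (2 * M / δ) := by
    intro z hz
    by_cases hza : z ∈ closedBall a δ
    · exact (hB1 z hza).trans (le_max_left _ _)
    · exact (hout z hz hza).trans (le_max_right _ _)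
  refine ⟨dslope f a, ?_, ⟨_, hB⟩, heq⟩
  refine of_norm_deriv_le (C := max B2 (max 1 (2 * M / δ) / δ)) hw hwi hd hf hf fun z hz => ?_
  have hnn := norm_nonneg (deriv f z)
  by_cases hza : z ∈ closedBall a δ
  · calc _ ≤ B2 := hB2 z hza
      _ ≤ max B2 (max 1 (2 * M / δ) / δ) * 1 := by rw [mul_one]; exact le_max_left _ _
      _ ≤ _ := by gcongr; linarith
  · have hza' : δ < ‖z - a‖ := by simpa [mem_closedBall, dist_eq_norm] using hza
    have hder : deriv f z = dslope f a z + (z - a) * deriv (dslope f a) z := by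
      have h1 : HasDerivAt (fun z => f a + (z - a) * dslope f a z)
          (1 * dslope f a z + (z - a) * deriv (dslope f a) z) z :=
        (((hasDerivAt_id z).sub_const a).mul
          (hd.differentiableAt (isOpen_ball.mem_nhds hz)).hasDerivAt).const_add (f a)
      have h2 : f = fun z => f a + (z - a) * dslope f a z := funext heq
      conv_lhs => rw [h2]
      rw [h1.deriv, one_mul]
    have h3 : ‖z - a‖ * ‖deriv (dslope f a) z‖ ≤ ‖deriv f z‖ + 2 * M / δ := by
      rw [← norm_mul]
      have : (z - a) * deriv (dslope f a) z = deriv f z - dslope f a z := by rw [hder]; ring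
      rw [this]
      exact (norm_sub_le _ _).trans (by gcongr; exact hout z hz hza)
    have h4 : ‖deriv (dslope f a) z‖ ≤ (‖deriv f z‖ + 2 * M / δ) / δ := by
      rw [le_div_iff₀ hδ]
      nlinarith [norm_nonneg (deriv (dslope f a) z)]
    calc _ ≤ (‖deriv f z‖ + 2 * M / δ) / δ := h4
      _ ≤ (max 1 (2 * M / δ) * (‖deriv f z‖ + ‖deriv f z‖ + 1)) / δ := by
        gcongr
        have h5 := le_max_left 1 (2 * M / δ)
        have h6 := le_max_right 1 (2 * M / δ)
        nlinarith
      _ = max 1 (2 * M / δ) / δ * (‖deriv f z‖ + ‖deriv f z‖ + 1) := by ring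
      _ ≤ _ := by gcongr; exact le_max_right _ _

end MemDirichletW

/-- The algebra of bounded functions in the weighted Dirichlet space. -/
def boundedDirichlet (w : ℂ → ℝ) (hw : ∀ z ∈ ball (0 : ℂ) 1, 0 < w z)
    (hwi : IntegrableOn w (ball 0 1)) : Subalgebra ℂ (ℂ → ℂ) where
  carrier := {f | MemDirichletW w f ∧ ∃ M, ∀ z ∈ ball (0 : ℂ) 1, ‖f z‖ ≤ M}
  mul_mem' := by
    rintro f g ⟨hf, M, hM⟩ ⟨hg, N, hN⟩
    refine ⟨hf.mul hw hwi hg (M := max M N) (fun z hz => (hM z hz).trans (le_max_left _ _))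
      (fun z hz => (hN z hz).trans (le_max_right _ _)), M * N, fun z hz => ?_⟩
    have h1 := hM z hz
    have h2 := hN z hz
    have := (norm_nonneg _).trans h1
    rw [Pi.mul_apply, norm_mul]
    gcongr
  add_mem' := by
    rintro f g ⟨hf, M, hM⟩ ⟨hg, N, hN⟩
    exact ⟨hf.add hw hwi hg, M + N, fun z hz =>
      (norm_add_le _ _).trans (add_le_add (hM z hz) (hN z hz))⟩
  algebraMap_mem' c := ⟨MemDirichletW.const c, ‖c‖, fun z _ => by simp⟩

namespace IsNonvanishingFunctional

variable {w : ℂ → ℝ} {Λ : (ℂ → ℂ) → ℂ} (hΛ : IsNonvanishingFunctional w Λ)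
  (hw : ∀ z ∈ ball (0 : ℂ) 1, 0 < w z) (hwi : IntegrableOn w (ball 0 1))
include hΛ

lemma map_const (c : ℂ) : Λ (fun _ => c) = c := by
  have : (fun _ => c : ℂ → ℂ) = c • (1 : ℂ → ℂ) := by ext; simp
  rw [this, hΛ.smul c 1 (MemDirichletW.const 1), hΛ.one, mul_one]

lemma map_sub_const {f : ℂ → ℂ} (hf : MemDirichletW w f) (c : ℂ) :
    Λ (fun z => f z - c) = Λ f - c := by
  have : (fun z => f z - c) = f + fun _ => -c := by ext; simp [sub_eq_add_neg]
  rw [this, hΛ.add _ _ hf (MemDirichletW.const _), hΛ.map_const, sub_eq_add_neg]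

include hw hwi

lemma exists_eq_map {f : ℂ → ℂ} (hf : MemDirichletW w f) :
    ∃ z ∈ ball (0 : ℂ) 1, f z = Λ f := by
  by_contra! h
  refine hΛ.ne_zero _ (hf.sub_const hw hwi (Λ f)) (fun z hz => sub_ne_zero.2 (h z hz)) ?_
  rw [hΛ.map_sub_const hf, sub_self]

/-- The restriction of the functional to bounded functions. -/
def toLinearMap : boundedDirichlet w hw hwi →ₗ[ℂ] ℂ where
  toFun f := Λ f
  map_add' f g := hΛ.add _ _ f.2.1 g.2.1
  map_smul' c f := hΛ.smul c _ f.2.1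

lemma map_mul_of_bounded (f g : boundedDirichlet w hw hwi) :
    Λ (f * g : ℂ → ℂ) = Λ f * Λ g := by
  refine LinearMap.map_mul_of_map_sq (hΛ.toLinearMap hw hwi) (fun x => ?_) f g
  obtain ⟨M, hM⟩ := x.2.2
  refine LinearMap.map_sq_of_roots_bounded _ hΛ.one x M fun n l hl => ?_
  by_contra! hlM
  have hx : ∀ z ∈ ball (0 : ℂ) 1, (l - x.1 z) ^ n ≠ 0 := by
    intro z hz
    refine pow_ne_zero _ (sub_ne_zero.2 fun h => ?_)
    exact absurd (hM z hz) (by rw [← h]; exact not_le.2 hlM)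
  exact hΛ.ne_zero _ ((algebraMap ℂ (boundedDirichlet w hw hwi) l - x) ^ n).2.1 hx hl

lemma exists_eval_of_bounded :
    ∃ a ∈ ball (0 : ℂ) 1, ∀ f, MemDirichletW w f →
      (∃ M, ∀ z ∈ ball (0 : ℂ) 1, ‖f z‖ ≤ M) → Λ f = f a := by
  have hid := MemDirichletW.id hw hwi
  obtain ⟨a, ha, haΛ⟩ := hΛ.exists_eq_map hw hwi hid
  refine ⟨a, ha, fun f hf ⟨M, hM⟩ => ?_⟩
  obtain ⟨q, hq, ⟨B, hB⟩, hfq⟩ := hf.exists_eqOn_sub_mul hw hwi hM ha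
  have hidb : ∀ z ∈ ball (0 : ℂ) 1, ‖z - a‖ ≤ 2 := fun z hz => by
    have h1 : ‖z‖ < 1 := by simpa using hz
    have h2 : ‖a‖ < 1 := by simpa using ha
    linarith [norm_sub_le z a]
  let s : boundedDirichlet w hw hwi := ⟨fun z => z - a, hid.sub_const hw hwi a, 2, hidb⟩
  let t : boundedDirichlet w hw hwi := ⟨q, hq, B, hB⟩
  have h1 := hΛ.map_mul_of_bounded hw hwi s t
  have h2 : Λ s = 0 := by
    change Λ (fun z => z - a) = 0
    rw [hΛ.map_sub_const hid, ← haΛ, sub_self]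
  have h3 : f = (fun _ => f a) + (s * t : ℂ → ℂ) := by ext z; exact hfq z
  have h4 : Λ f = f a + Λ s * Λ t := by
    rw [← h1]
    conv_lhs => rw [h3]
    rw [hΛ.add _ (s * t : ℂ → ℂ) (MemDirichletW.const _) (s * t).2.1, hΛ.map_const]
  rw [h4, h2, zero_mul, add_zero]

lemma eval_of_le_norm {a : ℂ} (ha : a ∈ ball (0 : ℂ) 1)
    (hbdd : ∀ f, MemDirichletW w f → (∃ M, ∀ z ∈ ball (0 : ℂ) 1, ‖f z‖ ≤ M) → Λ f = f a)
    {g : ℂ → ℂ} (hg : MemDirichletW w g) {δ : ℝ} (hδ : 0 < δ)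
    (hgδ : ∀ z ∈ ball (0 : ℂ) 1, δ ≤ ‖g z‖) : Λ g = g a := by
  have hg0 : ∀ z ∈ ball (0 : ℂ) 1, g z ≠ 0 := fun z hz h => by
    have := hgδ z hz
    rw [h, norm_zero] at this
    linarith
  by_contra hne
  have hga := hg0 a ha
  obtain ⟨μ, hμ⟩ : ∃ μ, Complex.exp μ = (g a - Λ g) / g a :=
    ⟨_, Complex.exp_log (div_ne_zero (sub_ne_zero.2 (Ne.symm hne)) hga)⟩
  let l := μ * g a
  let e : ℂ → ℂ := fun z => g z * Complex.exp (l / g z)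
  have hexp : ∀ z ∈ ball (0 : ℂ) 1, ‖l / g z‖ ≤ ‖l‖ / δ := fun z hz => by
    rw [norm_div]
    gcongr
    exact hgδ z hz
  have hexp' : ∀ z ∈ ball (0 : ℂ) 1, ‖Complex.exp (l / g z)‖ ≤ Real.exp (‖l‖ / δ) := fun z hz => by
    refine (Complex.norm_exp_le_exp_norm _).trans ?_
    exact Real.exp_le_exp.2 (hexp z hz)
  have hder : ∀ z ∈ ball (0 : ℂ) 1, HasDerivAt e (deriv g z * Complex.exp (l / g z) * (1 - l / g z)) z := by
    intro z hz
    have h1 := (hg.differentiableAt hz).hasDerivAt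
    have h2 := h1.mul ((((hasDerivAt_const z l).div h1 (hg0 z hz))).cexp)
    refine h2.congr_deriv ?_
    have := hg0 z hz
    simp only [Pi.div_apply, zero_mul, zero_sub]
    field_simp
    ring
  have he : MemDirichletW w e := by
    refine MemDirichletW.of_norm_deriv_le (C := Real.exp (‖l‖ / δ) * (1 + ‖l‖ / δ)) hw hwi
      (fun z hz => (hder z hz).differentiableAt.differentiableWithinAt) hg hg fun z hz => ?_
    rw [(hder z hz).deriv, norm_mul, norm_mul]
    have h1 : ‖1 - l / g z‖ ≤ 1 + ‖l‖ / δ := by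
      refine (norm_sub_le _ _).trans ?_
      rw [norm_one]
      linarith [hexp z hz]
    calc _ ≤ ‖deriv g z‖ * Real.exp (‖l‖ / δ) * (1 + ‖l‖ / δ) := by
          gcongr
          exact hexp' z hz
      _ = Real.exp (‖l‖ / δ) * (1 + ‖l‖ / δ) * ‖deriv g z‖ := by ring
      _ ≤ _ := by gcongr; linarith [norm_nonneg (deriv g z)]
  have hd : MemDirichletW w (e + (-1 : ℂ) • g) := he.add hw hwi (hg.const_smul hw hwi (-1))
  have hdb : ∀ z ∈ ball (0 : ℂ) 1, ‖(e + (-1 : ℂ) • g) z‖ ≤ ‖l‖ * Real.exp (‖l‖ / δ) := by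
    intro z hz
    have h1 : (e + (-1 : ℂ) • g) z = g z * (Complex.exp (l / g z) - 1) := by simp [e]; ring
    rw [h1, norm_mul]
    have h2 := Complex.norm_exp_sub_sum_le_norm_mul_exp (l / g z) 1
    simp only [Finset.range_one, Finset.sum_singleton, pow_zero, Nat.factorial_zero, Nat.cast_one,
      div_one, pow_one] at h2
    calc _ ≤ ‖g z‖ * (‖l / g z‖ * Real.exp ‖l / g z‖) := by gcongr
      _ = ‖l‖ * Real.exp ‖l / g z‖ := by
        rw [norm_div]
        have := norm_ne_zero_iff.2 (hg0 z hz)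
        field_simp
      _ ≤ _ := by gcongr; exact hexp z hz
  have h1 := hbdd _ hd ⟨_, hdb⟩
  rw [hΛ.add _ _ he (hg.const_smul hw hwi (-1)), hΛ.smul _ _ hg] at h1
  refine hΛ.ne_zero e he (fun z hz => mul_ne_zero (hg0 z hz) (Complex.exp_ne_zero _)) ?_
  have h2 : e a = g a - Λ g := by
    have h3 : l / g a = μ := by simp only [l]; field_simp
    simp only [e, h3, hμ]; field_simp
  simp only [Pi.add_apply, Pi.smul_apply, smul_eq_mul, h2] at h1
  linear_combination h1

lemma eval_of_re_nonneg {a : ℂ} (ha : a ∈ ball (0 : ℂ) 1)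
    (hbdd : ∀ f, MemDirichletW w f → (∃ M, ∀ z ∈ ball (0 : ℂ) 1, ‖f z‖ ≤ M) → Λ f = f a)
    {g : ℂ → ℂ} (hg : MemDirichletW w g) (hre : ∀ z ∈ ball (0 : ℂ) 1, 0 ≤ (g z).re) :
    Λ g = g a := by
  have h := hΛ.eval_of_le_norm hw hwi ha hbdd (hg.sub_const hw hwi (-1)) one_pos fun z hz => by
    have h1 := hre z hz
    refine le_trans ?_ (Complex.re_le_norm _)
    simp [h1]
  rw [hΛ.map_sub_const hg] at h
  linear_combination h

theorem exists_eval_of_decomposition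
    (hdec : ∀ f, MemDirichletW w f → ∃ F G, MemDirichletW w F ∧ MemDirichletW w G ∧
      (∀ z ∈ ball (0 : ℂ) 1, 0 ≤ (F z).re) ∧ (∀ z ∈ ball (0 : ℂ) 1, 0 ≤ (G z).re) ∧
      ∀ z ∈ ball (0 : ℂ) 1, f z = F z - G z) :
    ∃ a ∈ ball (0 : ℂ) 1, ∀ f, MemDirichletW w f → Λ f = f a := by
  obtain ⟨a, ha, hbdd⟩ := hΛ.exists_eval_of_bounded hw hwi
  refine ⟨a, ha, fun f hf => ?_⟩
  obtain ⟨F, G, hF, hG, hFr, hGr, hfFG⟩ := hdec f hf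
  have h1 : MemDirichletW w ((-1 : ℂ) • G) := hG.const_smul hw hwi (-1)
  rw [hΛ.congr f (F + (-1 : ℂ) • G) hf (hF.add hw hwi h1)
    (fun z hz => by rw [hfFG z hz]; simp [sub_eq_add_neg]), hΛ.add _ _ hF h1, hΛ.smul _ _ hG,
    hΛ.eval_of_re_nonneg hw hwi ha hbdd hF hFr, hΛ.eval_of_re_nonneg hw hwi ha hbdd hG hGr,
    hfFG a ha]
  ring

end IsNonvanishingFunctional

open scoped Real ENNReal

lemma lintegral_ball_eq_polar {g : ℂ → ℝ≥0∞} (hg : Measurable g) :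
    ∫⁻ h in ball (0 : ℂ) 1, g h = ∫⁻ ρ in Ioo (0 : ℝ) 1, ENNReal.ofReal ρ *
      ∫⁻ θ in Ioo (-π) π, g (ρ * Complex.exp (θ * I)) := by
  have hpm : Measurable fun p : ℝ × ℝ => (p.1 * Complex.exp (p.2 * I) : ℂ) := by fun_prop
  rw [← lintegral_indicator measurableSet_ball, ← Complex.lintegral_comp_polarCoord_symm,
    polarCoord_target, Measure.volume_eq_prod, ← Measure.prod_restrict, lintegral_prod]
  · rw [← lintegral_indicator measurableSet_Ioi, ← lintegral_indicator measurableSet_Ioo]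
    congr 1 with ρ
    by_cases h0 : 0 < ρ
    · have hnorm : ∀ θ : ℝ, ‖(ρ * Complex.exp (θ * I) : ℂ)‖ = ρ := fun θ => by
        rw [norm_mul, Complex.norm_exp_ofReal_mul_I, mul_one, Complex.norm_real,
          Real.norm_of_nonneg h0.le]
      have hpol : ∀ θ : ℝ, Complex.polarCoord.symm (ρ, θ) = ρ * Complex.exp (θ * I) := fun θ => by
        rw [Complex.polarCoord_symm_apply, Complex.exp_mul_I]
        push_cast
        rfl
      rw [indicator_of_mem (show ρ ∈ Ioi (0 : ℝ) from h0)]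
      by_cases h1 : ρ < 1
      · rw [indicator_of_mem (show ρ ∈ Ioo (0 : ℝ) 1 from ⟨h0, h1⟩), ← lintegral_const_mul]
        · refine lintegral_congr fun θ => ?_
          rw [hpol, indicator_of_mem (by simpa only [mem_ball_zero_iff, hnorm] using h1), smul_eq_mul]
        · exact hg.comp (by fun_prop)
      · rw [indicator_of_notMem (fun h => h1 h.2)]
        refine (lintegral_congr fun θ => ?_).trans lintegral_zero
        rw [hpol, indicator_of_notMem (by simpa only [mem_ball_zero_iff, hnorm] using h1), smul_zero]
    · rw [indicator_of_notMem (show ρ ∉ Ioi (0 : ℝ) from h0), indicator_of_notMem (fun h => h0 h.1)]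
  · refine Measurable.aemeasurable (Measurable.mul (by fun_prop) ?_)
    have h2 : Measurable fun p : ℝ × ℝ => Complex.polarCoord.symm p := by
      simp only [Complex.polarCoord_symm_apply]
      fun_prop
    exact (hg.indicator measurableSet_ball).comp h2

lemma lintegral_Ioo_ofReal : ∫⁻ ρ in Ioo (0 : ℝ) 1, ENNReal.ofReal ρ = ENNReal.ofReal (1 / 2) := by
  rw [← ofReal_integral_eq_lintegral_ofReal, ← integral_Ioc_eq_integral_Ioo,
    ← intervalIntegral.integral_of_le zero_le_one, integral_id]
  · norm_num
  · exact (continuous_id.integrableOn_Icc (a := (0 : ℝ)) (b := 1)).mono_set Ioo_subset_Icc_self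
  · exact (ae_restrict_iff' measurableSet_Ioo).2 (Filter.Eventually.of_forall fun x hx => hx.1.le)

lemma lintegral_ball_comp_neg (g : ℂ → ℝ≥0∞) :
    ∫⁻ h in ball (0 : ℂ) 1, g (-h) = ∫⁻ h in ball (0 : ℂ) 1, g h := by
  rw [← lintegral_indicator measurableSet_ball, ← lintegral_indicator measurableSet_ball,
    ← lintegral_neg_eq_self]
  congr 1 with h
  simp [indicator]

lemma integral_ball_eq_polar {g : ℂ → ℂ} (hg : Measurable g) {M : ℝ}
    (hM : ∀ h ∈ ball (0 : ℂ) 1, ‖g h‖ ≤ M) :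
    ∫ h in ball (0 : ℂ) 1, g h = ∫ ρ in Ioo (0 : ℝ) 1, ρ *
      ∫ θ in Ioo (-π) π, g (ρ * Complex.exp (θ * I)) := by
  have hpol : ∀ p : ℝ × ℝ, Complex.polarCoord.symm p = p.1 * Complex.exp (p.2 * I) := fun p => by
    rw [Complex.polarCoord_symm_apply, Complex.exp_mul_I]
    push_cast
    rfl
  have hnorm : ∀ p : ℝ × ℝ, ‖(p.1 * Complex.exp (p.2 * I) : ℂ)‖ = |p.1| := fun p => by
    rw [norm_mul, Complex.norm_exp_ofReal_mul_I, mul_one, Complex.norm_real, Real.norm_eq_abs]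
  have hball : ∀ p ∈ Ioo (0 : ℝ) 1 ×ˢ Ioo (-π) π,
      (p.1 * Complex.exp (p.2 * I) : ℂ) ∈ ball (0 : ℂ) 1 := fun p hp => by
    rw [mem_ball_zero_iff, hnorm, abs_of_pos hp.1.1]
    exact hp.1.2
  have hms : MeasurableSet (Ioo (0 : ℝ) 1 ×ˢ Ioo (-π) π) := measurableSet_Ioo.prod measurableSet_Ioo
  rw [← integral_indicator measurableSet_ball, ← Complex.integral_comp_polarCoord_symm,
    polarCoord_target, setIntegral_eq_of_subset_of_forall_sdiff_eq_zero
      (s := Ioo (0 : ℝ) 1 ×ˢ Ioo (-π) π) (measurableSet_Ioi.prod measurableSet_Ioo)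
      (prod_mono_left Ioo_subset_Ioi_self)]
  · rw [setIntegral_congr_fun (g := fun p : ℝ × ℝ => p.1 * g (p.1 * Complex.exp (p.2 * I))) hms]
    · rw [Measure.volume_eq_prod, setIntegral_prod]
      · simp_rw [integral_const_mul]
      · refine Measure.integrableOn_of_bounded (M := M) ?_ ?_ ?_
        · rw [Measure.prod_prod]
          simp
        · refine Measurable.aestronglyMeasurable (Measurable.mul (by fun_prop) (hg.comp ?_))
          fun_prop
        · refine (ae_restrict_iff' hms).2 (Filter.Eventually.of_forall fun p hp => ?_)
          rw [norm_mul, Complex.norm_real, Real.norm_eq_abs, abs_of_pos hp.1.1]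
          have h1 := hM _ (hball p hp)
          have h2 := hp.1.2
          have h3 := hp.1.1
          nlinarith [norm_nonneg (g (p.1 * Complex.exp (p.2 * I)))]
    · intro p hp
      simp only [hpol, indicator_of_mem (hball p hp), Complex.real_smul]
  · intro p hp
    have h1 : ¬ p.1 < 1 := fun h => hp.2 ⟨⟨hp.1.1, h⟩, hp.1.2⟩
    rw [hpol, indicator_of_notMem, smul_zero]
    rw [mem_ball_zero_iff, hnorm, abs_of_pos hp.1.1]
    exact h1

lemma add_mul_mem_closedBall {z h : ℂ} {t : ℝ} (ht : 0 < t) (hh : h ∈ ball (0 : ℂ) 1) :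
    z + t * h ∈ closedBall z t := by
  rw [mem_ball_zero_iff] at hh
  rw [mem_closedBall, dist_eq_norm, add_sub_cancel_left, norm_mul, Complex.norm_real,
    Real.norm_of_nonneg ht.le]
  nlinarith

/-- Area mean value property. -/
lemma integral_ball_comp_of_differentiableOn {f : ℂ → ℂ} {z : ℂ} {t : ℝ} (ht : 0 < t)
    (hf : DifferentiableOn ℂ f (closedBall z t)) :
    ∫ h in ball (0 : ℂ) 1, f (z + t * h) = π * f z := by
  classical
  obtain ⟨M, hM⟩ := (isCompact_closedBall z t).exists_bound_of_continuousOn hf.continuousOn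
  have hmaps : MapsTo (fun h : ℂ => z + t * h) (ball 0 1) (closedBall z t) :=
    fun h hh => add_mul_mem_closedBall ht hh
  have hmeas : Measurable ((ball (0 : ℂ) 1).piecewise (fun h => f (z + t * h)) 0) :=
    (hf.continuousOn.comp (by fun_prop) hmaps).measurable_piecewise continuousOn_const
      measurableSet_ball
  rw [setIntegral_congr_fun (g := (ball (0 : ℂ) 1).piecewise (fun h => f (z + t * h)) 0)
    measurableSet_ball (fun h hh => by simp only [piecewise_eq_of_mem _ _ _ hh]),
    integral_ball_eq_polar hmeas (M := M)
    (fun h hh => by rw [piecewise_eq_of_mem _ _ _ hh]; exact hM _ (hmaps hh))]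
  have hcirc : ∀ ρ ∈ Ioo (0 : ℝ) 1, (ρ : ℂ) * ∫ θ in Ioo (-π) π,
      (ball (0 : ℂ) 1).piecewise (fun h => f (z + t * h)) 0 (ρ * Complex.exp (θ * I)) =
      (ρ : ℂ) * (2 * π * f z) := by
    intro ρ hρ
    have hmem : ∀ θ : ℝ, (ρ * Complex.exp (θ * I) : ℂ) ∈ ball (0 : ℂ) 1 := fun θ => by
      rw [mem_ball_zero_iff, norm_mul, Complex.norm_exp_ofReal_mul_I, mul_one, Complex.norm_real,
        Real.norm_of_nonneg hρ.1.le]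
      exact hρ.2
    have htρ : |t * ρ| ≤ t := by rw [abs_of_pos (mul_pos ht hρ.1)]; nlinarith [hρ.2]
    have hmean : Real.circleAverage f z (t * ρ) = f z :=
      DiffContOnCl.circleAverage ((hf.mono (closedBall_subset_closedBall htρ)).diffContOnCl_ball
        le_rfl)
    have hper : Function.Periodic (fun θ : ℝ => f (circleMap z (t * ρ) θ)) (2 * π) := fun θ => by
      simp only [periodic_circleMap z (t * ρ) θ]
    have h1 := hper.intervalIntegral_add_eq 0 (-π)
    rw [zero_add, show -π + 2 * π = π by ring] at h1
    rw [Real.circleAverage_def, h1] at hmean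
    have h2 : ∫ θ in Ioo (-π) π,
        (ball (0 : ℂ) 1).piecewise (fun h => f (z + t * h)) 0 (ρ * Complex.exp (θ * I)) =
        ∫ θ in (-π)..π, f (circleMap z (t * ρ) θ) := by
      rw [intervalIntegral.integral_of_le (by linarith [Real.pi_pos]),
        integral_Ioc_eq_integral_Ioo]
      congr 1 with θ
      rw [piecewise_eq_of_mem _ _ _ (hmem θ), circleMap]
      push_cast
      rw [mul_assoc]
    rw [h2, ← hmean, Complex.real_smul]
    have := Real.pi_ne_zero
    push_cast
    field_simp
  have hofReal : ∫ ρ in Ioo (0 : ℝ) 1, (ρ : ℂ) = ((∫ ρ in Ioo (0 : ℝ) 1, ρ : ℝ) : ℂ) :=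
    integral_ofReal
  rw [setIntegral_congr_fun measurableSet_Ioo hcirc, integral_mul_const, hofReal,
    ← integral_Ioc_eq_integral_Ioo, ← intervalIntegral.integral_of_le zero_le_one, integral_id]
  push_cast
  ring

lemma lowerSemicontinuous_indicator_ball {w : ℂ → ℝ} (hw : ∀ z ∈ ball (0 : ℂ) 1, 0 < w z)
    (hlsc : LowerSemicontinuousOn w (ball 0 1)) :
    LowerSemicontinuous ((ball (0 : ℂ) 1).indicator w) := by
  intro z y hy
  by_cases hz : z ∈ ball (0 : ℂ) 1
  · rw [indicator_of_mem hz] at hy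
    have h1 := hlsc z hz y hy
    rw [nhdsWithin_eq_nhds.2 (isOpen_ball.mem_nhds hz)] at h1
    filter_upwards [h1, isOpen_ball.mem_nhds hz] with x hx hx'
    rwa [indicator_of_mem hx']
  · rw [indicator_of_notMem hz] at hy
    exact Filter.Eventually.of_forall fun x => hy.trans_le (indicator_nonneg (fun x hx => (hw x hx).le) x)

lemma finite_zeros_closedBall {g : ℂ → ℂ} (hg : DifferentiableOn ℂ g (ball 0 1))
    (hne : ∃ z ∈ ball (0 : ℂ) 1, g z ≠ 0) {K : Set ℂ} (hK : IsCompact K)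
    (hsub : K ⊆ ball (0 : ℂ) 1) : {x ∈ K | g x = 0}.Finite := by
  by_contra hinf
  obtain ⟨x, hx, hacc⟩ := Set.Infinite.exists_accPt_of_subset_isCompact hinf hK
    (sep_subset _ _)
  obtain ⟨z, hz, hgz⟩ := hne
  refine hgz ((hg.analyticOnNhd isOpen_ball).eqOn_zero_of_preconnected_of_frequently_eq_zero
    (convex_ball _ _).isPreconnected (hsub hx) ?_ hz)
  exact (accPt_iff_frequently_nhdsNE.1 hacc).mono fun y hy => hy.2

lemma lintegral_circle_le {w : ℂ → ℝ} (hw : ∀ z ∈ ball (0 : ℂ) 1, 0 < w z)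
    (hwsh : SuperharmonicOnDisk w) {z : ℂ} (hz : z ∈ ball (0 : ℂ) 1) {r : ℝ} (hr : 0 < r)
    (hsub : closedBall z r ⊆ ball 0 1) {g : ℂ → ℂ} (hg : DifferentiableOn ℂ g (ball 0 1))
    (hg0 : ∀ x ∈ sphere z r, g x ≠ 0)
    (hfin : ∫⁻ θ in Ioo (-π) π, ENNReal.ofReal
      (‖g (z + r * Complex.exp (θ * I))‖ ^ 2 * w (z + r * Complex.exp (θ * I))) < ∞) :
    ∫⁻ θ in Ioo (-π) π, ENNReal.ofReal (w (z + r * Complex.exp (θ * I))) ≤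
      ENNReal.ofReal (2 * π * w z) := by
  have hmem : ∀ θ : ℝ, z + r * Complex.exp (θ * I) ∈ sphere z r := fun θ => by
    rw [mem_sphere, dist_eq_norm, add_sub_cancel_left, norm_mul, Complex.norm_exp_ofReal_mul_I,
      mul_one, Complex.norm_real, Real.norm_of_nonneg hr.le]
  have hballmem : ∀ θ : ℝ, z + r * Complex.exp (θ * I) ∈ ball (0 : ℂ) 1 := fun θ =>
    hsub (sphere_subset_closedBall (hmem θ))
  obtain ⟨x0, hx0, hmin⟩ := (isCompact_sphere z r).exists_isMinOn
    ((NormedSpace.sphere_nonempty (E := ℂ)).2 hr.le)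
    (hg.continuousOn.mono (sphere_subset_closedBall.trans hsub)).norm
  have hc : 0 < ‖g x0‖ := norm_pos_iff.2 (hg0 x0 hx0)
  have hpos : ∀ θ : ℝ, 0 < w (z + r * Complex.exp (θ * I)) := fun θ => hw _ (hballmem θ)
  have hmeas : Measurable fun θ : ℝ => w (z + r * Complex.exp (θ * I)) := by
    have h1 := (lowerSemicontinuous_indicator_ball hw hwsh.1).measurable.comp
      (show Measurable fun θ : ℝ => z + r * Complex.exp (θ * I) by fun_prop)
    convert h1 using 1
    exact funext fun θ => (indicator_of_mem (hballmem θ) _).symm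
  have hfin' : ∫⁻ θ in Ioo (-π) π, ENNReal.ofReal (w (z + r * Complex.exp (θ * I))) < ∞ := by
    refine lt_of_le_of_lt ?_ (ENNReal.mul_lt_top (a := ENNReal.ofReal ((‖g x0‖ ^ 2)⁻¹))
      ENNReal.ofReal_lt_top hfin)
    rw [← lintegral_const_mul' _ _ ENNReal.ofReal_ne_top]
    refine lintegral_mono fun θ => ?_
    rw [← ENNReal.ofReal_mul (by positivity)]
    refine ENNReal.ofReal_le_ofReal ?_
    have h1 : ‖g x0‖ ≤ ‖g (z + r * Complex.exp (θ * I))‖ := hmin (hmem θ)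
    have h2 := hpos θ
    rw [le_inv_mul_iff₀ (by positivity)]
    gcongr
  have hint : IntegrableOn (fun θ : ℝ => w (z + r * Complex.exp (θ * I))) (Ioo (-π) π) := by
    refine ⟨hmeas.aestronglyMeasurable, ?_⟩
    rw [hasFiniteIntegral_iff_ofReal (Filter.Eventually.of_forall fun θ => (hpos θ).le)]
    exact hfin'
  rw [← ofReal_integral_eq_lintegral_ofReal hint
    (Filter.Eventually.of_forall fun θ => (hpos θ).le)]
  refine ENNReal.ofReal_le_ofReal ?_
  have h1 := hwsh.2 z hz r hr hsub
  have hper : Function.Periodic (fun θ : ℝ => w (z + r * Complex.exp (θ * I))) (2 * π) := fun θ => by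
    have := periodic_circleMap z r θ
    simp only [circleMap] at this
    simp only [this]
  have h2 := hper.intervalIntegral_add_eq 0 (-π)
  rw [zero_add, show -π + 2 * π = π by ring] at h2
  rw [h2, intervalIntegral.integral_of_le (by linarith [Real.pi_pos]),
    integral_Ioc_eq_integral_Ioo, one_div, inv_mul_le_iff₀ (by positivity)] at h1
  exact h1

lemma lintegral_ball_le {w : ℂ → ℝ} (hw : ∀ z ∈ ball (0 : ℂ) 1, 0 < w z)
    (hwsh : SuperharmonicOnDisk w) {f : ℂ → ℂ} (hf : MemDirichletW w f)
    (hne : ∃ z ∈ ball (0 : ℂ) 1, deriv f z ≠ 0) {z : ℂ} {t : ℝ} (ht : 0 < t)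
    (hsub : closedBall z t ⊆ ball 0 1) :
    ∫⁻ h in ball (0 : ℂ) 1, ENNReal.ofReal ((ball (0 : ℂ) 1).indicator w (z + t * h)) ≤
      ENNReal.ofReal (π * w z) := by
  have hz : z ∈ ball (0 : ℂ) 1 := hsub (mem_closedBall_self ht.le)
  have hd := hf.1.deriv isOpen_ball
  set v := (ball (0 : ℂ) 1).indicator w with hv
  have hvm : Measurable v := (lowerSemicontinuous_indicator_ball hw hwsh.1).measurable
  have hmap : Measurable fun h : ℂ => z + t * h := by fun_prop
  have hpolmem : ∀ ρ ∈ Ioo (0 : ℝ) 1, ∀ θ : ℝ,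
      z + t * (ρ * Complex.exp (θ * I)) ∈ ball (0 : ℂ) 1 := fun ρ hρ θ => by
    refine hsub (add_mul_mem_closedBall ht ?_)
    rw [mem_ball_zero_iff, norm_mul, Complex.norm_exp_ofReal_mul_I, mul_one, Complex.norm_real,
      Real.norm_of_nonneg hρ.1.le]
    exact hρ.2
  have hGm : Measurable fun h : ℂ => ENNReal.ofReal (‖deriv f (z + t * h)‖ ^ 2 * v (z + t * h)) := by
    have := measurable_deriv f
    fun_prop
  have hfin : ∫⁻ h in ball (0 : ℂ) 1,
      ENNReal.ofReal (‖deriv f (z + t * h)‖ ^ 2 * v (z + t * h)) < ∞ := by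
    refine (setLIntegral_le_lintegral _ _).trans_lt ?_
    have h1 : Integrable fun x => ‖deriv f x‖ ^ 2 * v x := by
      have := hf.2.integrable_indicator measurableSet_ball
      refine this.congr (Filter.Eventually.of_forall fun x => ?_)
      simp only [hv, indicator]
      split_ifs <;> simp
    have h2 : Integrable fun h : ℂ => ‖deriv f (z + t * h)‖ ^ 2 * v (z + t * h) := by
      have h3 := (h1.comp_add_left z).comp_smul (R := t) ht.ne'
      simpa only [Complex.real_smul] using h3
    have h3 := h2.2
    rwa [hasFiniteIntegral_iff_ofReal (Filter.Eventually.of_forall fun h => ?_)] at h3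
    exact mul_nonneg (by positivity) (indicator_nonneg (fun x hx => (hw x hx).le) _)
  rw [lintegral_ball_eq_polar hGm] at hfin
  rw [lintegral_ball_eq_polar (by fun_prop)]
  have hbound : ∀ᵐ ρ ∂(volume.restrict (Ioo (0 : ℝ) 1)), ENNReal.ofReal ρ *
      ∫⁻ θ in Ioo (-π) π, ENNReal.ofReal (v (z + t * (ρ * Complex.exp (θ * I)))) ≤
      ENNReal.ofReal ρ * ENNReal.ofReal (2 * π * w z) := by
    have hae := ae_lt_top (by
      refine Measurable.mul (by fun_prop) (Measurable.lintegral_prod_right' (f := fun p : ℝ × ℝ =>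
        ENNReal.ofReal (‖deriv f (z + t * (p.1 * Complex.exp (p.2 * I)))‖ ^ 2 *
          v (z + t * (p.1 * Complex.exp (p.2 * I))))) ?_)
      exact hGm.comp (show Measurable fun p : ℝ × ℝ => (p.1 * Complex.exp (p.2 * I) : ℂ) by fun_prop))
      hfin.ne
    have hzeros := finite_zeros_closedBall hd hne (isCompact_closedBall z t) hsub
    have hnull := (hzeros.image fun x => ‖x - z‖ / t).measure_zero (volume : Measure ℝ)
    have hnull' := ae_restrict_of_ae (s := Ioo (0 : ℝ) 1) (compl_mem_ae_iff.2 hnull)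
    filter_upwards [hae, hnull', ae_restrict_mem measurableSet_Ioo] with ρ h1 h2 hρ
    gcongr
    have htρ : t * ρ ≤ t := by nlinarith [hρ.2]
    have hcoe : ∀ θ : ℝ, z + t * (ρ * Complex.exp (θ * I)) =
        z + ((t * ρ : ℝ) : ℂ) * Complex.exp (θ * I) := fun θ => by push_cast; ring
    have hve : ∀ θ : ℝ, v (z + t * (ρ * Complex.exp (θ * I))) =
        w (z + ((t * ρ : ℝ) : ℂ) * Complex.exp (θ * I)) := fun θ => by
      rw [hv, indicator_of_mem (hpolmem ρ hρ θ), hcoe]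
    simp only [hve]
    refine lintegral_circle_le hw hwsh hz (mul_pos ht hρ.1)
      ((closedBall_subset_closedBall htρ).trans hsub) hd (fun x hx hx0 => h2 ⟨x, ⟨?_, hx0⟩, ?_⟩) ?_
    · exact closedBall_subset_closedBall htρ (sphere_subset_closedBall hx)
    · rw [mem_sphere, dist_eq_norm] at hx
      simp only [hx]
      field_simp
    · simp only [hve] at h1
      simp only [hcoe] at h1
      exact (ENNReal.mul_lt_top_iff.1 h1).elim (fun h => h.2) (fun h => h.elim
        (fun h => absurd h (by simpa using hρ.1)) (fun h => by rw [h]; exact ENNReal.zero_lt_top))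
  refine (lintegral_mono_ae hbound).trans ?_
  rw [lintegral_mul_const' _ _ ENNReal.ofReal_ne_top, lintegral_Ioo_ofReal,
    ← ENNReal.ofReal_mul (by norm_num)]
  exact ENNReal.ofReal_le_ofReal (le_of_eq (by ring))

lemma integrable_indicator_of_lintegral_le {v : ℂ → ℝ} (hv : LowerSemicontinuous v)
    (hv0 : ∀ z, 0 ≤ v z) {C : ℝ}
    (hmean : ∀ t ∈ Ioo (0 : ℝ) 1,
      ∫⁻ h in ball (0 : ℂ) 1, ENNReal.ofReal (v (t * h)) ≤ ENNReal.ofReal C) :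
    IntegrableOn v (ball 0 1) := by
  refine ⟨hv.measurable.aestronglyMeasurable, ?_⟩
  rw [hasFiniteIntegral_iff_ofReal (Filter.Eventually.of_forall hv0)]
  refine lt_of_le_of_lt ?_ (ENNReal.ofReal_lt_top (r := C))
  have hlsc : LowerSemicontinuous fun z => ENNReal.ofReal (v z) :=
    ENNReal.continuous_ofReal.comp_lowerSemicontinuous hv fun _ _ h => ENNReal.ofReal_le_ofReal h
  have hmem : ∀ n : ℕ, 1 - 1 / ((n : ℝ) + 2) ∈ Ioo (0 : ℝ) 1 := fun n => by
    have h1 : 1 / ((n : ℝ) + 2) < 1 := by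
      rw [div_lt_one (by positivity)]
      linarith [n.cast_nonneg (α := ℝ)]
    have h2 : 0 < 1 / ((n : ℝ) + 2) := by positivity
    constructor <;> linarith
  have hlim : Filter.Tendsto (fun n : ℕ => 1 - 1 / ((n : ℝ) + 2)) Filter.atTop (nhds 1) := by
    have h1 : Filter.Tendsto (fun n : ℕ => (n : ℝ) + 2) Filter.atTop Filter.atTop :=
      Filter.tendsto_atTop_add_const_right _ _ tendsto_natCast_atTop_atTop
    simpa using (h1.inv_tendsto_atTop).const_sub 1
  calc ∫⁻ h in ball (0 : ℂ) 1, ENNReal.ofReal (v h)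
      ≤ ∫⁻ h in ball (0 : ℂ) 1, Filter.liminf (fun n : ℕ =>
          ENNReal.ofReal (v ((1 - 1 / ((n : ℝ) + 2) : ℝ) * h))) Filter.atTop := by
        refine lintegral_mono fun h => ?_
        refine (LowerSemicontinuousAt.le_liminf (hlsc h)).trans ?_
        have h1 : Filter.Tendsto (fun n : ℕ => ((1 - 1 / ((n : ℝ) + 2) : ℝ) : ℂ) * h)
            Filter.atTop (nhds h) := by
          have := ((Complex.continuous_ofReal.tendsto _).comp hlim).mul_const h
          simpa using this
        exact (Filter.liminf_le_liminf_of_le h1).trans (le_of_eq (Filter.liminf_comp _ _ _).symm)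
    _ ≤ Filter.liminf (fun n : ℕ => ∫⁻ h in ball (0 : ℂ) 1,
          ENNReal.ofReal (v ((1 - 1 / ((n : ℝ) + 2) : ℝ) * h))) Filter.atTop :=
        lintegral_liminf_le fun n => by
          have := hv.measurable
          fun_prop
    _ ≤ ENNReal.ofReal C := by
        refine Filter.liminf_le_of_frequently_le' (Filter.Frequently.of_forall fun n => ?_)
        exact hmean _ (hmem n)

lemma integral_ball_norm_sq : ∫ h in ball (0 : ℂ) 1, ‖h‖ ^ 2 = π / 2 := by
  have h1 := integral_ball_eq_polar (g := fun h => ((‖h‖ ^ 2 : ℝ) : ℂ)) (M := 1) (by fun_prop)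
    (fun h hh => by
      rw [mem_ball_zero_iff] at hh
      rw [Complex.norm_real, Real.norm_of_nonneg (by positivity)]
      nlinarith [norm_nonneg h])
  have h2 : ∀ ρ : ℝ, (ρ : ℂ) * ∫ θ in Ioo (-π) π,
      ((‖(ρ * Complex.exp (θ * I) : ℂ)‖ ^ 2 : ℝ) : ℂ) = ((2 * π * ρ ^ 3 : ℝ) : ℂ) := fun ρ => by
    simp only [norm_mul, Complex.norm_exp_ofReal_mul_I, mul_one, Complex.norm_real,
      Real.norm_eq_abs, sq_abs, integral_const, MeasurableSet.univ, measureReal_restrict_apply,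
      Set.univ_inter, Real.volume_real_Ioo, sub_neg_eq_add, Complex.real_smul]
    rw [max_eq_left (by positivity)]
    push_cast
    ring
  simp only [h2] at h1
  rw [integral_complex_ofReal, integral_complex_ofReal, Complex.ofReal_inj] at h1
  rw [h1, integral_const_mul, ← integral_Ioc_eq_integral_Ioo,
    ← intervalIntegral.integral_of_le zero_le_one, integral_pow]
  norm_num
  ring

lemma integrableOn_ball_of_continuousOn_closedBall {E : Type*} [NormedAddCommGroup E] {φ : ℂ → E}
    {z : ℂ} {t : ℝ} (ht : 0 < t) (hφ : ContinuousOn φ (closedBall z t)) :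
    IntegrableOn (fun h => φ (z + t * h)) (ball 0 1) := by
  have h1 : ContinuousOn (fun h : ℂ => φ (z + t * h)) (closedBall 0 1) := by
    refine hφ.comp (by fun_prop) fun h hh => ?_
    rw [mem_closedBall_zero_iff] at hh
    rw [mem_closedBall, dist_eq_norm, add_sub_cancel_left, norm_mul, Complex.norm_real,
      Real.norm_of_nonneg ht.le]
    nlinarith
  exact (h1.integrableOn_compact (isCompact_closedBall 0 1)).mono_set ball_subset_closedBall

lemma integral_ball_re_of_differentiableOn {f : ℂ → ℂ} {z : ℂ} {t : ℝ} (ht : 0 < t)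
    (hf : DifferentiableOn ℂ f (closedBall z t)) :
    IntegrableOn (fun h => (f (z + t * h)).re) (ball 0 1) ∧
      ∫ h in ball (0 : ℂ) 1, (f (z + t * h)).re = π * (f z).re := by
  have hint := integrableOn_ball_of_continuousOn_closedBall ht hf.continuousOn
  refine ⟨hint.re, ?_⟩
  have h1 : ∫ h in ball (0 : ℂ) 1, (f (z + t * h)).re =
      (∫ h in ball (0 : ℂ) 1, f (z + t * h)).re := integral_re hint
  rw [h1, integral_ball_comp_of_differentiableOn ht hf, Complex.re_ofReal_mul]

lemma integrableOn_ball_const (c : ℝ) : IntegrableOn (fun _ : ℂ => c) (ball 0 1) :=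
  integrableOn_const measure_ball_lt_top.ne

lemma pi_mul_norm_sq_le_integral_ball {g : ℂ → ℂ} {z : ℂ} {t : ℝ} (ht : 0 < t)
    (hg : DifferentiableOn ℂ g (closedBall z t)) :
    π * ‖g z‖ ^ 2 ≤ ∫ h in ball (0 : ℂ) 1, ‖g (z + t * h)‖ ^ 2 := by
  obtain ⟨hint, h2⟩ := integral_ball_re_of_differentiableOn ht
    ((hg.sub_const (g z)).const_mul ((starRingEnd ℂ) (g z)))
  rw [sub_self, mul_zero, Complex.zero_re, mul_zero] at h2
  have h3 : π * ‖g z‖ ^ 2 = ∫ h in ball (0 : ℂ) 1,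
      (‖g z‖ ^ 2 + 2 * ((starRingEnd ℂ) (g z) * (g (z + t * h) - g z)).re) := by
    rw [integral_add (integrableOn_ball_const _) (hint.const_mul 2), integral_const_mul, h2]
    simp [Measure.real, Complex.volume_ball]
  rw [h3]
  refine integral_mono ((integrableOn_ball_const _).add (hint.const_mul 2))
    (integrableOn_ball_of_continuousOn_closedBall ht (hg.continuousOn.norm.pow 2)) fun h => ?_
  simp only [← Complex.normSq_eq_norm_sq, Complex.normSq_apply, Complex.mul_re, Complex.conj_re,
    Complex.conj_im, Complex.sub_re, Complex.sub_im]
  nlinarith [sq_nonneg ((g (z + t * h)).re - (g z).re), sq_nonneg ((g (z + t * h)).im - (g z).im)]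

lemma integral_ball_one_sub_norm_sq {z : ℂ} {t : ℝ} (ht : 0 < t) :
    ∫ h in ball (0 : ℂ) 1, (1 - ‖z + t * h‖ ^ 2) = π * (1 - ‖z‖ ^ 2) - π / 2 * t ^ 2 := by
  obtain ⟨hint, h2⟩ := integral_ball_re_of_differentiableOn
    (f := fun x => (starRingEnd ℂ) z * (x - z)) (z := z) ht (by fun_prop)
  rw [sub_self, mul_zero, Complex.zero_re, mul_zero] at h2
  have hint2 : IntegrableOn (fun h : ℂ => ‖h‖ ^ 2) (ball 0 1) :=
    ((continuous_norm.pow 2).continuousOn.integrableOn_compact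
      (isCompact_closedBall 0 1)).mono_set ball_subset_closedBall
  have h4 : ∀ h : ℂ, 1 - ‖z + t * h‖ ^ 2 = (1 - ‖z‖ ^ 2) -
      2 * ((starRingEnd ℂ) z * (z + t * h - z)).re - t ^ 2 * ‖h‖ ^ 2 := fun h => by
    simp only [← Complex.normSq_eq_norm_sq, Complex.normSq_apply, Complex.mul_re, Complex.conj_re,
      Complex.conj_im, Complex.add_re, Complex.add_im, Complex.sub_re, Complex.sub_im,
      Complex.mul_im, Complex.ofReal_re, Complex.ofReal_im]
    ring
  simp only [h4]
  have hA : IntegrableOn (fun h : ℂ => (1 - ‖z‖ ^ 2) -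
      2 * ((starRingEnd ℂ) z * (z + t * h - z)).re) (ball 0 1) :=
    (integrableOn_ball_const _).sub (hint.const_mul 2)
  rw [integral_sub hA (hint2.const_mul _),
    integral_sub (integrableOn_ball_const _) (hint.const_mul 2), integral_const_mul,
    integral_const_mul, h2, integral_ball_norm_sq]
  simp [Measure.real, Complex.volume_ball]
  ring

lemma integrableOn_and_integral_le_of_lintegral_le {φ : ℂ → ℝ} {s : Set ℂ} (hm : Measurable φ)
    (h0 : ∀ z, 0 ≤ φ z) {C : ℝ} (hC : 0 ≤ C)
    (h : ∫⁻ z in s, ENNReal.ofReal (φ z) ≤ ENNReal.ofReal C) :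
    IntegrableOn φ s ∧ ∫ z in s, φ z ≤ C := by
  refine ⟨⟨hm.aestronglyMeasurable, ?_⟩, ?_⟩
  · rw [hasFiniteIntegral_iff_ofReal (Filter.Eventually.of_forall h0)]
    exact h.trans_lt ENNReal.ofReal_lt_top
  · rw [integral_eq_lintegral_of_nonneg_ae (Filter.Eventually.of_forall h0) hm.aestronglyMeasurable]
    exact ENNReal.toReal_le_of_le_ofReal hC h

/-- A positive function on the disk which is bounded below by its area means dominates a multiple
of `1 - ‖z‖ ^ 2`. -/
lemma exists_mul_one_sub_norm_sq_le {w : ℂ → ℝ} (hw : ∀ z ∈ ball (0 : ℂ) 1, 0 < w z)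
    (hlsc : LowerSemicontinuousOn w (ball 0 1))
    (hmean : ∀ (z : ℂ) (t : ℝ), 0 < t → closedBall z t ⊆ ball 0 1 →
      ∫⁻ h in ball (0 : ℂ) 1, ENNReal.ofReal ((ball (0 : ℂ) 1).indicator w (z + t * h)) ≤
        ENNReal.ofReal (π * w z)) :
    ∃ c > 0, ∀ z ∈ ball (0 : ℂ) 1, c * (1 - ‖z‖ ^ 2) ≤ w z := by
  have hv := lowerSemicontinuous_indicator_ball hw hlsc
  set v := (ball (0 : ℂ) 1).indicator w with hvdef
  have hvw : ∀ z ∈ ball (0 : ℂ) 1, v z = w z := fun z hz => indicator_of_mem hz _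
  have hsub : closedBall (0 : ℂ) (1 / 2) ⊆ ball 0 1 := closedBall_subset_ball (by norm_num)
  obtain ⟨x, hx, hxmin⟩ := (hlsc.mono hsub).exists_isMinOn
    (nonempty_closedBall.2 (by norm_num)) (isCompact_closedBall (0 : ℂ) (1 / 2))
  have hm := hw x (hsub hx)
  set m := w x with hmdef
  let φ : ℂ → ℝ := fun z => v z + (m / 6 * (1 - ‖z‖ ^ 2) - m / 3 * (‖z⁻¹‖ ^ 2 - 1))
  let K : Set ℂ := closedBall 0 1 \ ball 0 (1 / 2)
  have hK : IsCompact K := (isCompact_closedBall 0 1).diff isOpen_ball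
  have hK0 : ∀ z ∈ K, z ≠ 0 := by
    rintro z hz rfl
    exact hz.2 (mem_ball_self (by norm_num))
  have hcont : ContinuousOn (fun z : ℂ =>
      m / 6 * (1 - ‖z‖ ^ 2) - m / 3 * (‖z⁻¹‖ ^ 2 - 1)) K := by
    have : ContinuousOn (fun z : ℂ => z⁻¹) K := continuousOn_inv₀.mono hK0
    fun_prop
  have hφ : LowerSemicontinuousOn φ K :=
    (hv.lowerSemicontinuousOn K).add hcont.lowerSemicontinuousOn
  have h1K : (1 : ℂ) ∈ K := ⟨by simp, by simp; norm_num⟩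
  obtain ⟨y, hyK, hymin⟩ := hφ.exists_isMinOn ⟨1, h1K⟩ hK
  have hy1 : ‖y‖ ≤ 1 := by simpa using hyK.1
  have hy2 : 1 / 2 ≤ ‖y‖ := by simpa using hyK.2
  have hφy : 0 ≤ φ y := by
    by_contra! hneg
    have hlt1 : ‖y‖ < 1 := by
      refine lt_of_le_of_ne hy1 fun h => ?_
      simp only [φ, norm_inv, h] at hneg
      norm_num at hneg
      exact absurd hneg (not_lt.2 (indicator_nonneg (fun x hx => (hw x hx).le) y))
    have hlt2 : 1 / 2 < ‖y‖ := by
      refine lt_of_le_of_ne hy2 fun h => ?_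
      have h1 : m ≤ w y := hxmin (by rw [mem_closedBall_zero_iff]; exact h.ge)
      simp only [φ, norm_inv, ← h, hvw y (mem_ball_zero_iff.2 hlt1)] at hneg
      norm_num at hneg
      linarith
    have hopen : IsOpen (ball (0 : ℂ) 1 \ closedBall 0 (1 / 2)) :=
      isOpen_ball.sdiff isClosed_closedBall
    obtain ⟨t, ht, hts⟩ := Metric.nhds_basis_closedBall.mem_iff.1 (hopen.mem_nhds
      (show y ∈ ball (0 : ℂ) 1 \ closedBall 0 (1 / 2) from
        ⟨mem_ball_zero_iff.2 hlt1, by simpa using hlt2⟩))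
    have hyb : y ∈ ball (0 : ℂ) 1 := mem_ball_zero_iff.2 hlt1
    have hinv : DifferentiableOn ℂ (fun z : ℂ => z⁻¹) (closedBall y t) := fun z hz => by
      refine (differentiableAt_inv fun h => (hts hz).2 ?_).differentiableWithinAt
      rw [h]
      exact mem_closedBall_self (by norm_num)
    obtain ⟨hvi, hvle⟩ := integrableOn_and_integral_le_of_lintegral_le
      (hv.measurable.comp (show Measurable fun h : ℂ => y + t * h by fun_prop))
      (fun h => indicator_nonneg (fun x hx => (hw x hx).le) _)
      (mul_nonneg Real.pi_pos.le (hw y hyb).le) (hmean y t ht (hts.trans sdiff_subset))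
    have hqi := integrableOn_ball_of_continuousOn_closedBall (φ := fun x : ℂ => 1 - ‖x‖ ^ 2) (z := y)
      ht (by fun_prop)
    have hq := integral_ball_one_sub_norm_sq (z := y) ht
    have hii : IntegrableOn (fun h : ℂ => ‖(y + t * h)⁻¹‖ ^ 2) (ball 0 1) :=
      integrableOn_ball_of_continuousOn_closedBall ht (hinv.continuousOn.norm.pow 2)
    have hi := pi_mul_norm_sq_le_integral_ball ht hinv
    have hii' : IntegrableOn (fun h : ℂ => ‖(y + t * h)⁻¹‖ ^ 2 - 1) (ball 0 1) :=
      hii.sub (integrableOn_ball_const _)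
    have hφi : IntegrableOn (fun h : ℂ => φ (y + t * h)) (ball 0 1) :=
      hvi.add ((hqi.const_mul _).sub (hii'.const_mul _))
    have hle : ∫ h in ball (0 : ℂ) 1, φ y ≤ ∫ h in ball (0 : ℂ) 1, φ (y + t * h) := by
      refine setIntegral_mono_on (integrableOn_ball_const _) hφi measurableSet_ball fun h hh => ?_
      have h1 := hts (add_mul_mem_closedBall ht hh)
      exact hymin ⟨ball_subset_closedBall h1.1, fun h2 => h1.2 (ball_subset_closedBall h2)⟩
    have heq : ∫ h in ball (0 : ℂ) 1, φ (y + t * h) =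
        (∫ h in ball (0 : ℂ) 1, v (y + t * h)) +
          (m / 6 * (∫ h in ball (0 : ℂ) 1, (1 - ‖y + t * h‖ ^ 2)) -
            m / 3 * ((∫ h in ball (0 : ℂ) 1, ‖(y + t * h)⁻¹‖ ^ 2) - π)) := by
      have e1 := integral_add hvi ((hqi.const_mul (m / 6)).sub (hii'.const_mul (m / 3)))
      have e2 := integral_sub (hqi.const_mul (m / 6)) (hii'.const_mul (m / 3))
      have e3 := integral_sub hii (integrableOn_ball_const 1)
      simp only [integral_const_mul] at e2
      have e4 : ∫ _ in ball (0 : ℂ) 1, (1 : ℝ) = π := by simp [Measure.real, Complex.volume_ball]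
      rw [e4] at e3
      rw [e3] at e2
      rw [← e2]
      exact e1
    have hconst : ∫ h in ball (0 : ℂ) 1, φ y = π * φ y := by
      simp [Measure.real, Complex.volume_ball]
    rw [hconst, heq, hq] at hle
    have hφyeq : φ y = w y + (m / 6 * (1 - ‖y‖ ^ 2) - m / 3 * (‖y⁻¹‖ ^ 2 - 1)) := by
      simp only [φ, hvw y hyb]
    rw [hφyeq] at hle
    have hvle' : ∫ h in ball (0 : ℂ) 1, v (y + t * h) ≤ π * w y := hvle
    have hp : 0 < m * (π * t ^ 2) := by positivity
    nlinarith
  refine ⟨m / 6, by positivity, fun z hz => ?_⟩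
  have hz1 : ‖z‖ < 1 := by simpa using hz
  by_cases hz2 : z ∈ ball (0 : ℂ) (1 / 2)
  · have h1 : m ≤ w z := hxmin (ball_subset_closedBall hz2)
    nlinarith [sq_nonneg ‖z‖]
  · have h1 : 0 ≤ φ z := hφy.trans (hymin ⟨ball_subset_closedBall hz, hz2⟩)
    have hz3 : 1 / 2 ≤ ‖z‖ := by simpa using hz2
    have h2 : 1 - ‖z‖ ^ 2 ≤ ‖z⁻¹‖ ^ 2 - 1 := by
      rw [norm_inv, inv_pow]
      have h3 : 0 < ‖z‖ ^ 2 := by positivity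
      have h4 : ‖z‖ ^ 2 * (‖z‖ ^ 2)⁻¹ = 1 := mul_inv_cancel₀ h3.ne'
      have h5 : 0 < (‖z‖ ^ 2)⁻¹ := by positivity
      nlinarith [sq_nonneg (‖z‖ ^ 2 - 1)]
    simp only [φ, hvw z hz] at h1
    nlinarith

/-- Weights on the disk, extended by zero, whose area means satisfy a quantitative strict
super-mean-value inequality. -/
structure IsStrictWeight (W : ℂ → ℝ) : Prop where
  measurable : Measurable W
  nonneg : ∀ z, 0 ≤ W z
  integrable : IntegrableOn W (ball 0 1)
  le_mul : ∀ (z : ℂ) (t : ℝ), 0 < t → closedBall z t ⊆ ball 0 1 → π / 2 * t ^ 2 ≤ π * W z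
  mean_le : ∀ (z : ℂ) (t : ℝ), 0 < t → closedBall z t ⊆ ball 0 1 →
    ∫⁻ h in ball (0 : ℂ) 1, ENNReal.ofReal (W (z + t * h)) ≤
      ENNReal.ofReal (π * W z - π / 2 * t ^ 2)

/-- If the weighted Dirichlet space contains a nonconstant function, then the weight is comparable
to a strict weight. -/
lemma exists_isStrictWeight {w : ℂ → ℝ} (hw : ∀ z ∈ ball (0 : ℂ) 1, 0 < w z)
    (hwsh : SuperharmonicOnDisk w) {f : ℂ → ℂ} (hf : MemDirichletW w f)
    (hne : ∃ z ∈ ball (0 : ℂ) 1, deriv f z ≠ 0) :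
    IntegrableOn w (ball 0 1) ∧ ∃ W, IsStrictWeight W ∧ ∃ C, ∀ z ∈ ball (0 : ℂ) 1,
      w z ≤ W z ∧ W z ≤ C * w z := by
  have hmean := fun (z : ℂ) (t : ℝ) (ht : 0 < t) (hsub : closedBall z t ⊆ ball 0 1) =>
    lintegral_ball_le hw hwsh hf hne ht hsub
  obtain ⟨c, hc, hcw⟩ := exists_mul_one_sub_norm_sq_le hw hwsh.1 hmean
  have hv := lowerSemicontinuous_indicator_ball hw hwsh.1
  have hv0 : ∀ z, 0 ≤ (ball (0 : ℂ) 1).indicator w z := indicator_nonneg fun x hx => (hw x hx).le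
  have hvi : IntegrableOn ((ball (0 : ℂ) 1).indicator w) (ball 0 1) := by
    refine integrable_indicator_of_lintegral_le hv hv0 (C := π * w 0) fun t ht => ?_
    have := hmean 0 t ht.1 (closedBall_subset_ball ht.2)
    simpa using this
  refine ⟨hvi.congr_fun (fun z hz => indicator_of_mem hz _) measurableSet_ball,
    fun z => (ball (0 : ℂ) 1).indicator w z + max 0 (1 - ‖z‖ ^ 2), ?_, 1 + c⁻¹, fun z hz => ?_⟩
  · have hmax : ∀ x ∈ ball (0 : ℂ) 1, max 0 (1 - ‖x‖ ^ 2) = 1 - ‖x‖ ^ 2 := fun x hx => by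
      have := mem_ball_zero_iff.1 hx
      exact max_eq_right (by nlinarith [norm_nonneg x])
    have hnn : ∀ (z : ℂ) (t : ℝ), 0 < t → closedBall z t ⊆ ball 0 1 → ∀ h ∈ ball (0 : ℂ) 1,
        0 ≤ 1 - ‖z + t * h‖ ^ 2 := fun z t ht hsub h hh =>
      (le_max_left _ _).trans (hmax _ (hsub (add_mul_mem_closedBall ht hh))).le
    have hq0 : ∀ (z : ℂ) (t : ℝ), 0 < t → closedBall z t ⊆ ball 0 1 →
        0 ≤ π * (1 - ‖z‖ ^ 2) - π / 2 * t ^ 2 := fun z t ht hsub => by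
      rw [← integral_ball_one_sub_norm_sq ht]
      exact setIntegral_nonneg measurableSet_ball (hnn z t ht hsub)
    refine ⟨hv.measurable.add (by fun_prop), fun z => add_nonneg (hv0 z) (le_max_left _ _),
      hvi.add ?_, fun z t ht hsub => ?_, fun z t ht hsub => ?_⟩
    · have h1 : Continuous fun z : ℂ => max 0 (1 - ‖z‖ ^ 2) := by fun_prop
      exact (h1.continuousOn.integrableOn_compact
        (isCompact_closedBall 0 1)).mono_set ball_subset_closedBall
    · rw [hmax z (hsub (mem_closedBall_self ht.le)), mul_add]
      linarith [hq0 z t ht hsub, mul_nonneg Real.pi_pos.le (hv0 z)]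
    · have hz : z ∈ ball (0 : ℂ) 1 := hsub (mem_closedBall_self ht.le)
      have hqi := integrableOn_ball_of_continuousOn_closedBall (φ := fun x : ℂ => 1 - ‖x‖ ^ 2)
        (z := z) ht (by fun_prop)
      have hq : ∫⁻ h in ball (0 : ℂ) 1, ENNReal.ofReal (max 0 (1 - ‖z + t * h‖ ^ 2)) =
          ENNReal.ofReal (π * (1 - ‖z‖ ^ 2) - π / 2 * t ^ 2) := by
        rw [← integral_ball_one_sub_norm_sq ht, ofReal_integral_eq_lintegral_ofReal hqi
          ((ae_restrict_iff' measurableSet_ball).2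
            (Filter.Eventually.of_forall (hnn z t ht hsub)))]
        exact lintegral_congr fun h => by simp
      simp_rw [ENNReal.ofReal_add (hv0 _) (le_max_left _ _)]
      rw [lintegral_add_right _ (by fun_prop), hq]
      refine (add_le_add_left (hmean z t ht hsub) _).trans (le_of_eq ?_)
      rw [← ENNReal.ofReal_add (mul_nonneg Real.pi_pos.le (hw z hz).le) (hq0 z t ht hsub), hmax z hz,
        indicator_of_mem hz]
      ring_nf
  · have h1 := mem_ball_zero_iff.1 hz
    have h2 : 0 ≤ 1 - ‖z‖ ^ 2 := by nlinarith [norm_nonneg z]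
    simp only [indicator_of_mem hz, max_eq_right h2]
    refine ⟨by linarith, ?_⟩
    have h3 : 1 - ‖z‖ ^ 2 ≤ c⁻¹ * w z := by
      rw [le_inv_mul_iff₀ hc]
      exact hcw z hz
    linarith

lemma exists_taylor_bounds {F : ℂ → ℂ} (hF : DifferentiableOn ℂ F (ball 0 1)) {r : ℝ} (hr : r < 1) :
    ∃ L, 0 ≤ L ∧ ∀ z ∈ closedBall (0 : ℂ) r, ‖deriv F z‖ ≤ L ∧ ∀ x ∈ closedBall (0 : ℂ) r,
      ‖F x - F z‖ ≤ L * ‖x - z‖ ∧ ‖F x - F z - deriv F z * (x - z)‖ ≤ L * ‖x - z‖ ^ 2 := by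
  have hsub : closedBall (0 : ℂ) r ⊆ ball 0 1 := closedBall_subset_ball hr
  have hF1 := hF.deriv isOpen_ball
  have hF2 := hF1.deriv isOpen_ball
  obtain ⟨L1, hL1⟩ := (isCompact_closedBall (0 : ℂ) r).exists_bound_of_continuousOn
    (hF1.continuousOn.mono hsub)
  obtain ⟨L2, hL2⟩ := (isCompact_closedBall (0 : ℂ) r).exists_bound_of_continuousOn
    (hF2.continuousOn.mono hsub)
  have hda : ∀ x ∈ closedBall (0 : ℂ) r, HasDerivAt F (deriv F x) x := fun x hx =>
    (hF.differentiableAt (isOpen_ball.mem_nhds (hsub hx))).hasDerivAt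
  have hda1 : ∀ x ∈ closedBall (0 : ℂ) r, HasDerivAt (deriv F) (deriv (deriv F) x) x := fun x hx =>
    (hF1.differentiableAt (isOpen_ball.mem_nhds (hsub hx))).hasDerivAt
  have hconv := convex_closedBall (0 : ℂ) r
  refine ⟨max 0 (max L1 L2), le_max_left _ _, fun z hz => ⟨(hL1 z hz).trans (by simp),
    fun x hx => ⟨?_, ?_⟩⟩⟩
  · exact (hconv.norm_image_sub_le_of_norm_hasDerivWithin_le
      (fun y hy => (hda y hy).hasDerivWithinAt) hL1 hz hx).trans (by gcongr; simp)
  · have hseg : ∀ y ∈ segment ℝ z x, ‖deriv F y - deriv F z‖ ≤ L2 * ‖x - z‖ := fun y hy => by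
      have h1 := hconv.norm_image_sub_le_of_norm_hasDerivWithin_le
        (fun y hy => (hda1 y hy).hasDerivWithinAt) hL2 hz (hconv.segment_subset hz hx hy)
      refine h1.trans (mul_le_mul_of_nonneg_left ?_ ((norm_nonneg _).trans (hL2 z hz)))
      exact norm_sub_le_of_mem_segment hy
    have h2 := (convex_segment (𝕜 := ℝ) z x).norm_image_sub_le_of_norm_hasDerivWithin_le
      (f := fun y => F y - deriv F z * y) (fun y hy =>
        ((hda y (hconv.segment_subset hz hx hy)).sub
          ((hasDerivAt_id y).const_mul (deriv F z))).hasDerivWithinAt)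
      (fun y hy => by rw [mul_one]; exact hseg y hy) (left_mem_segment ℝ z x)
      (right_mem_segment ℝ z x)
    calc ‖F x - F z - deriv F z * (x - z)‖
        = ‖F x - deriv F z * x - (F z - deriv F z * z)‖ := by congr 1; ring
      _ ≤ L2 * ‖x - z‖ * ‖x - z‖ := h2
      _ = L2 * ‖x - z‖ ^ 2 := by ring
      _ ≤ _ := by gcongr; simp

/-- Second order expansion of the area means of the product of two harmonic functions. -/
lemma le_integral_ball_re_mul_re {F G : ℂ → ℂ} {z : ℂ} {t L : ℝ} (ht : 0 < t) (hL : 0 ≤ L)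
    (hF : DifferentiableOn ℂ F (closedBall z t)) (hG : DifferentiableOn ℂ G (closedBall z t))
    (hF' : ‖deriv F z‖ ≤ L)
    (hFL : ∀ x ∈ closedBall z t, ‖F x - F z - deriv F z * (x - z)‖ ≤ L * ‖x - z‖ ^ 2)
    (hGL : ∀ x ∈ closedBall z t, ‖G x - G z‖ ≤ L * ‖x - z‖ ∧
      ‖G x - G z - deriv G z * (x - z)‖ ≤ L * ‖x - z‖ ^ 2) :
    π * ((F z).re * (G z).re) + π / 4 * t ^ 2 * (deriv F z * (starRingEnd ℂ) (deriv G z)).re -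
      π * L ^ 2 * t ^ 3 ≤ ∫ h in ball (0 : ℂ) 1, (F (z + t * h)).re * (G (z + t * h)).re := by
  set Q := (deriv F z * (starRingEnd ℂ) (deriv G z)).re with hQ
  let Φ : ℂ → ℂ := fun x => (F z).re * (G z).re + (F z).re * (G x - G z) + (G z).re * (F x - F z) +
    1 / 2 * ((F x - F z) * (G x - G z))
  have hΦ : DifferentiableOn ℂ Φ (closedBall z t) := by fun_prop
  obtain ⟨hΦi, hΦe⟩ := integral_ball_re_of_differentiableOn ht hΦ
  have hint2 : IntegrableOn (fun h : ℂ => ‖h‖ ^ 2) (ball 0 1) :=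
    ((continuous_norm.pow 2).continuousOn.integrableOn_compact
      (isCompact_closedBall 0 1)).mono_set ball_subset_closedBall
  have hlow : IntegrableOn (fun h : ℂ => (Φ (z + t * h)).re + (1 / 2 * t ^ 2 * Q * ‖h‖ ^ 2 -
      L ^ 2 * t ^ 3)) (ball 0 1) :=
    hΦi.add ((hint2.const_mul _).sub (integrableOn_ball_const _))
  have hlowe : ∫ h in ball (0 : ℂ) 1, ((Φ (z + t * h)).re + (1 / 2 * t ^ 2 * Q * ‖h‖ ^ 2 -
      L ^ 2 * t ^ 3)) = π * ((F z).re * (G z).re) + π / 4 * t ^ 2 * Q - π * L ^ 2 * t ^ 3 := by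
    have e1 := integral_add hΦi
      ((hint2.const_mul (1 / 2 * t ^ 2 * Q)).sub (integrableOn_ball_const (L ^ 2 * t ^ 3)))
    have e2 := integral_sub (hint2.const_mul (1 / 2 * t ^ 2 * Q))
      (integrableOn_ball_const (L ^ 2 * t ^ 3))
    rw [integral_const_mul, integral_ball_norm_sq] at e2
    refine e1.trans ?_
    have e3 : ∫ _ in ball (0 : ℂ) 1, L ^ 2 * t ^ 3 = π * (L ^ 2 * t ^ 3) := by
      simp [Measure.real, Complex.volume_ball]
    have e4 : (Φ z).re = (F z).re * (G z).re := by simp [Φ]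
    rw [hΦe, e4]
    rw [e3] at e2
    refine (congrArg _ e2).trans ?_
    ring
  rw [← hlowe]
  refine setIntegral_mono_on hlow (integrableOn_ball_of_continuousOn_closedBall ht
    (φ := fun x => (F x).re * (G x).re) ?_) measurableSet_ball fun h hh => ?_
  · exact (Complex.continuous_re.comp_continuousOn hF.continuousOn).mul
      (Complex.continuous_re.comp_continuousOn hG.continuousOn)
  have hx := add_mul_mem_closedBall (z := z) ht hh
  set x := z + t * h with hxdef
  have hxz : x - z = t * h := by rw [hxdef]; ring
  have hh1 : ‖h‖ < 1 := by simpa using hh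
  have hn : ‖x - z‖ ≤ t := by rw [← dist_eq_norm]; exact hx
  set a := F x - F z - deriv F z * (x - z) with ha
  set b := G x - G z - deriv G z * (x - z) with hb
  have hprod : (F x).re * (G x).re = (Φ x).re +
      1 / 2 * ((F x - F z) * (starRingEnd ℂ) (G x - G z)).re := by
    simp [Φ]
    ring
  have hsplit : (F x - F z) * (starRingEnd ℂ) (G x - G z) =
      (deriv F z * (starRingEnd ℂ) (deriv G z)) * ((‖x - z‖ ^ 2 : ℝ) : ℂ) +
      (a * (starRingEnd ℂ) (G x - G z) + deriv F z * (x - z) * (starRingEnd ℂ) b) := by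
    have h1 : ((‖x - z‖ ^ 2 : ℝ) : ℂ) = (x - z) * (starRingEnd ℂ) (x - z) := by
      rw [Complex.mul_conj, Complex.normSq_eq_norm_sq]
    rw [h1, ha, hb]
    simp only [map_sub, map_mul]
    ring
  have herr : ‖a * (starRingEnd ℂ) (G x - G z) + deriv F z * (x - z) * (starRingEnd ℂ) b‖ ≤
      2 * (L ^ 2 * t ^ 3) := by
    calc _ ≤ ‖a‖ * ‖G x - G z‖ + ‖deriv F z‖ * ‖x - z‖ * ‖b‖ := by
          refine (norm_add_le _ _).trans (le_of_eq ?_)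
          simp only [norm_mul, RCLike.norm_conj]
      _ ≤ (L * ‖x - z‖ ^ 2) * (L * ‖x - z‖) + L * ‖x - z‖ * (L * ‖x - z‖ ^ 2) := by
          gcongr
          · exact hFL x hx
          · exact (hGL x hx).1
          · exact (hGL x hx).2
      _ = 2 * (L ^ 2 * ‖x - z‖ ^ 3) := by ring
      _ ≤ _ := by gcongr
  have hre := (abs_le.1 ((Complex.abs_re_le_norm _).trans herr)).1
  have hnorm : ‖x - z‖ ^ 2 = t ^ 2 * ‖h‖ ^ 2 := by
    rw [hxz, norm_mul, Complex.norm_real, Real.norm_of_nonneg ht.le, mul_pow]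
  have hsplit_re := congrArg Complex.re hsplit
  rw [Complex.add_re, Complex.re_mul_ofReal, ← hQ, hnorm] at hsplit_re
  rw [hprod, hsplit_re]
  linarith

/-- Area means in the weighted pairing can be moved from the test function to the weight. -/
lemma IsStrictWeight.integrableOn_mul_mean {W η : ℂ → ℝ} (hW : IsStrictWeight W)
    (hη : Measurable η) (h0 : ∀ z, 0 ≤ η z) {M r t : ℝ} (hM : ∀ z, η z ≤ M)
    (hr : ∀ z, η z ≠ 0 → z ∈ closedBall (0 : ℂ) r) (ht : 0 < t) (hrt : r + t < 1) :
    IntegrableOn (fun z => W z * ∫ h in ball (0 : ℂ) 1, η (z + t * h)) (ball 0 1) ∧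
      ∫ z in ball (0 : ℂ) 1, W z * ∫ h in ball (0 : ℂ) 1, η (z + t * h) ≤
        ∫ z in ball (0 : ℂ) 1, η z * (π * W z - π / 2 * t ^ 2) := by
  have hsub : ∀ z, η z ≠ 0 → closedBall z t ⊆ ball 0 1 := fun z hz x hx => by
    have h1 := hr z hz
    rw [mem_closedBall] at h1 hx
    rw [mem_ball]
    linarith [dist_triangle x z 0]
  have hpos : ∀ z, 0 ≤ η z * (π * W z - π / 2 * t ^ 2) := fun z => by
    by_cases hz : η z = 0
    · simp [hz]
    · exact mul_nonneg (h0 z) (sub_nonneg.2 (hW.le_mul z t ht (hsub z hz)))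
  have hηb : ∀ᵐ z ∂volume.restrict (ball (0 : ℂ) 1), ‖η z‖ ≤ M :=
    ae_of_all _ fun z => by rw [Real.norm_of_nonneg (h0 z)]; exact hM z
  have hint : IntegrableOn (fun z => η z * (π * W z - π / 2 * t ^ 2)) (ball 0 1) :=
    ((hW.integrable.const_mul π).sub (integrableOn_ball_const (π / 2 * t ^ 2))).bdd_mul
      hη.aestronglyMeasurable hηb
  have hcomp : Measurable fun p : ℂ × ℂ => η (p.1 + t * p.2) := hη.comp (by fun_prop)
  have hA : Measurable fun z => ∫ h in ball (0 : ℂ) 1, η (z + t * h) :=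
    hcomp.stronglyMeasurable.integral_prod_right.measurable
  refine integrableOn_and_integral_le_of_lintegral_le (hW.measurable.mul hA)
    (fun z => mul_nonneg (hW.nonneg z) (integral_nonneg fun h => h0 _))
    (setIntegral_nonneg measurableSet_ball fun z _ => hpos z) ?_
  have hηi : ∀ z, IntegrableOn (fun h => η (z + t * h)) (ball 0 1) := fun z =>
    Measure.integrableOn_of_bounded measure_ball_lt_top.ne
      (hη.comp (by fun_prop)).aestronglyMeasurable
      (ae_of_all _ fun h => by rw [Real.norm_of_nonneg (h0 _)]; exact hM _)
  have hWm := hW.measurable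
  calc ∫⁻ z in ball (0 : ℂ) 1, ENNReal.ofReal (W z * ∫ h in ball (0 : ℂ) 1, η (z + t * h))
      = ∫⁻ z in ball (0 : ℂ) 1, ∫⁻ h in ball (0 : ℂ) 1,
          ENNReal.ofReal (W z) * ENNReal.ofReal (η (z + t * h)) := by
        refine lintegral_congr fun z => ?_
        rw [ENNReal.ofReal_mul (hW.nonneg z),
          ofReal_integral_eq_lintegral_ofReal (hηi z) (ae_of_all _ fun h => h0 _),
          lintegral_const_mul]
        exact (hη.comp (g := η) (f := fun h : ℂ => z + t * h) (by fun_prop)).ennreal_ofReal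
    _ ≤ ∫⁻ z, ∫⁻ h in ball (0 : ℂ) 1,
          ENNReal.ofReal (W z) * ENNReal.ofReal (η (z + t * h)) := setLIntegral_le_lintegral _ _
    _ = ∫⁻ h in ball (0 : ℂ) 1, ∫⁻ z,
          ENNReal.ofReal (W z) * ENNReal.ofReal (η (z + t * h)) :=
        lintegral_lintegral_swap
          ((hWm.comp measurable_fst).ennreal_ofReal.mul hcomp.ennreal_ofReal).aemeasurable
    _ = ∫⁻ h in ball (0 : ℂ) 1, ∫⁻ z,
          ENNReal.ofReal (W (z + t * -h)) * ENNReal.ofReal (η z) := by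
        refine lintegral_congr fun h => ?_
        rw [← lintegral_add_right_eq_self (fun z => ENNReal.ofReal (W (z + t * -h)) *
          ENNReal.ofReal (η z)) (t * h : ℂ)]
        simp
    _ = ∫⁻ z, ∫⁻ h in ball (0 : ℂ) 1,
          ENNReal.ofReal (W (z + t * -h)) * ENNReal.ofReal (η z) := by
        refine lintegral_lintegral_swap (Measurable.aemeasurable ?_)
        exact (hWm.comp (by fun_prop)).ennreal_ofReal.mul (hη.comp measurable_snd).ennreal_ofReal
    _ = ∫⁻ z, ENNReal.ofReal (η z) * ∫⁻ h in ball (0 : ℂ) 1, ENNReal.ofReal (W (z + t * h)) := by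
        refine lintegral_congr fun z => ?_
        rw [lintegral_mul_const, mul_comm,
          lintegral_ball_comp_neg fun h => ENNReal.ofReal (W (z + t * h))]
        exact (hWm.comp (g := W) (f := fun h : ℂ => z + t * -h) (by fun_prop)).ennreal_ofReal
    _ ≤ ∫⁻ z, ENNReal.ofReal (η z * (π * W z - π / 2 * t ^ 2)) := by
        refine lintegral_mono fun z => ?_
        by_cases hz : η z = 0
        · simp [hz]
        · rw [ENNReal.ofReal_mul (h0 z)]
          gcongr
          exact hW.mean_le z t ht (hsub z hz)
    _ = ∫⁻ z in ball (0 : ℂ) 1, ENNReal.ofReal (η z * (π * W z - π / 2 * t ^ 2)) := by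
        rw [← lintegral_indicator measurableSet_ball]
        refine lintegral_congr fun z => ?_
        by_cases hz : η z = 0
        · simp [hz, indicator]
        · rw [indicator_of_mem (hsub z hz (mem_closedBall_self ht.le))]
    _ ≤ ENNReal.ofReal (∫ z in ball (0 : ℂ) 1, η z * (π * W z - π / 2 * t ^ 2)) := by
        rw [ofReal_integral_eq_lintegral_ofReal hint (ae_of_all _ hpos)]

/-- If the product of two harmonic functions is less than `ε` on a circle, then it is less than
`ε` on a neighbourhood of this circle in the disk. -/
lemma exists_radius_of_lt_on_sphere {φ : ℂ → ℝ} {r ε : ℝ} (hr : 0 < r)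
    (hφ : ContinuousOn φ (closedBall 0 r)) (hs : ∀ z ∈ sphere (0 : ℂ) r, φ z < ε) :
    ∃ s, 0 ≤ s ∧ s < r ∧ ∀ z ∈ closedBall (0 : ℂ) r, ε ≤ φ z → ‖z‖ ≤ s := by
  have hK : IsCompact {z ∈ closedBall (0 : ℂ) r | ε ≤ φ z} :=
    (isCompact_closedBall 0 r).of_isClosed_subset
      (hφ.preimage_isClosed_of_isClosed isClosed_closedBall isClosed_Ici) (sep_subset _ _)
  rcases {z ∈ closedBall (0 : ℂ) r | ε ≤ φ z}.eq_empty_or_nonempty with he | hne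
  · refine ⟨0, le_rfl, hr, fun z hz hzε => ?_⟩
    exact absurd (he.subset ⟨hz, hzε⟩) (notMem_empty z)
  · obtain ⟨x, hx, hmax⟩ := hK.exists_isMaxOn hne continuous_norm.continuousOn
    refine ⟨‖x‖, norm_nonneg _, lt_of_le_of_ne (by simpa using hx.1) fun h => ?_,
      fun z hz hzε => hmax ⟨hz, hzε⟩⟩
    exact absurd (hs x (by simpa using h)) (not_lt.2 hx.2)

lemma IsStrictWeight.setIntegral_le_zero {W : ℂ → ℝ} (hW : IsStrictWeight W) {F G : ℂ → ℂ}
    (hF : DifferentiableOn ℂ F (ball 0 1)) (hG : DifferentiableOn ℂ G (ball 0 1)) {r ε : ℝ}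
    (hr0 : 0 < r) (hr1 : r < 1) (hs : ∀ z ∈ sphere (0 : ℂ) r, (F z).re * (G z).re < ε) {S : Set ℂ}
    (hS : S = {z ∈ ball (0 : ℂ) r | ε < (F z).re * (G z).re}) :
    MeasurableSet S ∧
    IntegrableOn (fun z => (deriv F z * (starRingEnd ℂ) (deriv G z)).re * W z) S ∧
    IntegrableOn (fun z => (F z).re * (G z).re - ε) S ∧
    ∫ z in S, ((deriv F z * (starRingEnd ℂ) (deriv G z)).re * W z +
      2 * ((F z).re * (G z).re - ε)) ≤ 0 := by
  have hrsub : closedBall (0 : ℂ) r ⊆ ball 0 1 := closedBall_subset_ball hr1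
  have hUY : ContinuousOn (fun z => (F z).re * (G z).re) (ball 0 1) :=
    (Complex.continuous_re.comp_continuousOn hF.continuousOn).mul
      (Complex.continuous_re.comp_continuousOn hG.continuousOn)
  obtain ⟨s, hs0, hsr, hsub⟩ := exists_radius_of_lt_on_sphere hr0 (hUY.mono hrsub) hs
  have hSr : S ⊆ closedBall 0 r := fun z hz => by rw [hS] at hz; exact ball_subset_closedBall hz.1
  have hS1 : S ⊆ ball 0 1 := hSr.trans hrsub
  have hSs : ∀ z ∈ S, ‖z‖ ≤ s := fun z hz => hsub z (hSr hz) (by rw [hS] at hz; exact hz.2.le)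
  have hSo : IsOpen S := by
    rw [hS]
    exact (hUY.mono (ball_subset_closedBall.trans hrsub)).isOpen_inter_preimage isOpen_ball
      isOpen_Ioi
  obtain ⟨L1, hL1, hFL⟩ := exists_taylor_bounds hF hr1
  obtain ⟨L2, hL2, hGL⟩ := exists_taylor_bounds hG hr1
  set L := max L1 L2
  have hL : 0 ≤ L := hL1.trans (le_max_left _ _)
  have hWS : IntegrableOn W S := hW.integrable.mono_set hS1
  have hQm : ContinuousOn (fun z => (deriv F z * (starRingEnd ℂ) (deriv G z)).re) (ball 0 1) :=
    Complex.continuous_re.comp_continuousOn ((hF.deriv isOpen_ball).continuousOn.mul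
      (Complex.continuous_conj.comp_continuousOn (hG.deriv isOpen_ball).continuousOn))
  have hQW : IntegrableOn (fun z => (deriv F z * (starRingEnd ℂ) (deriv G z)).re * W z) S := by
    obtain ⟨C, hC⟩ := (isCompact_closedBall (0 : ℂ) r).exists_bound_of_continuousOn
      (hQm.mono hrsub)
    exact hWS.bdd_mul ((hQm.mono hS1).aestronglyMeasurable hSo.measurableSet)
      ((ae_restrict_mem hSo.measurableSet).mono fun z hz => hC z (hSr hz))
  obtain ⟨M, hM⟩ := (isCompact_closedBall (0 : ℂ) r).exists_bound_of_continuousOn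
    ((hUY.sub continuousOn_const).mono hrsub : ContinuousOn (fun z => (F z).re * (G z).re - ε) _)
  have hUYi : IntegrableOn (fun z => (F z).re * (G z).re - ε) S :=
    (((hUY.sub continuousOn_const).mono hrsub).integrableOn_compact
      (isCompact_closedBall 0 r)).mono_set hSr
  refine ⟨hSo.measurableSet, hQW, hUYi, ?_⟩
  set η : ℂ → ℝ := S.indicator fun z => (F z).re * (G z).re - ε with hη
  have hηm : Measurable η := by
    classical
    rw [hη, ← piecewise_eq_indicator]
    exact ((hUY.sub continuousOn_const).mono hS1).measurable_piecewise continuousOn_const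
      hSo.measurableSet
  have hη0 : ∀ z, 0 ≤ η z := indicator_nonneg fun z hz => by
    rw [hS] at hz
    exact sub_nonneg.2 hz.2.le
  have hM0 : 0 ≤ M := (norm_nonneg _).trans (hM 0 (mem_closedBall_self hr0.le))
  have hηM : ∀ z, η z ≤ M := fun z => by
    by_cases hz : z ∈ S
    · rw [hη, indicator_of_mem hz]
      exact (le_abs_self _).trans (hM z (hSr hz))
    · rw [hη, indicator_of_notMem hz]
      exact hM0
  have hηs : ∀ z, η z ≠ 0 → z ∈ closedBall (0 : ℂ) s := fun z hz => by
    simpa using hSs z (mem_of_indicator_ne_zero hz)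
  have key : ∀ t ∈ Ioo 0 (r - s), ∫ z in S, ((deriv F z * (starRingEnd ℂ) (deriv G z)).re * W z +
      2 * ((F z).re * (G z).re - ε)) ≤ (4 * L ^ 2 * ∫ z in S, W z) * t := by
    rintro t ⟨ht, hts⟩
    obtain ⟨hAi, hA⟩ := hW.integrableOn_mul_mean hηm hη0 hηM hηs ht (by linarith)
    have hlow : ∀ z, π * η z + S.indicator (fun z => π / 4 * t ^ 2 *
        (deriv F z * (starRingEnd ℂ) (deriv G z)).re - π * L ^ 2 * t ^ 3) z ≤
        ∫ h in ball (0 : ℂ) 1, η (z + t * h) := fun z => by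
      by_cases hz : z ∈ S
      · have hzt : closedBall z t ⊆ ball 0 r := closedBall_subset_ball' (by
          rw [dist_zero_right]
          linarith [hSs z hz])
        have hzt1 := hzt.trans (ball_subset_closedBall.trans hrsub)
        have hT := le_integral_ball_re_mul_re ht hL (hF.mono hzt1) (hG.mono hzt1)
          ((hFL z (hSr hz)).1.trans (le_max_left _ _))
          (fun x hx => ((hFL z (hSr hz)).2 x (ball_subset_closedBall (hzt hx))).2.trans
            (by gcongr; exact le_max_left _ _))
          (fun x hx => ⟨((hGL z (hSr hz)).2 x (ball_subset_closedBall (hzt hx))).1.trans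
            (by gcongr; exact le_max_right _ _),
            ((hGL z (hSr hz)).2 x (ball_subset_closedBall (hzt hx))).2.trans
            (by gcongr; exact le_max_right _ _)⟩)
        have hi := integrableOn_ball_of_continuousOn_closedBall ht (hUY.mono hzt1)
        have hsubi := integral_sub hi (integrableOn_ball_const ε)
        have he : ∫ _ in ball (0 : ℂ) 1, ε = π * ε := by
          simp [Measure.real, Complex.volume_ball]
        have hmono : ∫ h in ball (0 : ℂ) 1, ((F (z + t * h)).re * (G (z + t * h)).re - ε) ≤
            ∫ h in ball (0 : ℂ) 1, η (z + t * h) := by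
          refine setIntegral_mono_on (hi.sub (integrableOn_ball_const ε))
            (Measure.integrableOn_of_bounded measure_ball_lt_top.ne
              (hηm.comp (by fun_prop)).aestronglyMeasurable
              (ae_of_all _ fun h => by rw [Real.norm_of_nonneg (hη0 _)]; exact hηM _))
            measurableSet_ball fun h hh => ?_
          by_cases hx : z + t * h ∈ S
          · rw [hη, indicator_of_mem hx]
          · rw [hη, indicator_of_notMem hx]
            rw [hS] at hx
            exact sub_nonpos.2 (not_lt.1 fun h' => hx ⟨hzt (add_mul_mem_closedBall ht hh), h'⟩)
        rw [he] at hsubi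
        refine le_trans ?_ (hsubi.symm.le.trans hmono)
        rw [hη, indicator_of_mem hz, indicator_of_mem hz]
        linarith
      · rw [hη, indicator_of_notMem hz, indicator_of_notMem hz]
        simpa using integral_nonneg fun h => hη0 (z + t * h)
    have hηW : IntegrableOn (fun z => η z * (π * W z - π / 2 * t ^ 2)) (ball 0 1) :=
      ((hW.integrable.const_mul π).sub (integrableOn_ball_const (π / 2 * t ^ 2))).bdd_mul
        hηm.aestronglyMeasurable
        (ae_of_all _ fun z => by rw [Real.norm_of_nonneg (hη0 z)]; exact hηM z)
    have hdiff : 0 ≤ ∫ z in ball (0 : ℂ) 1, (η z * (π * W z - π / 2 * t ^ 2) -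
        W z * ∫ h in ball (0 : ℂ) 1, η (z + t * h)) := by
      rw [integral_sub hηW hAi]
      linarith
    have hSi₀ : IntegrableOn (fun z => π / 4 * t ^ 2 *
        ((deriv F z * (starRingEnd ℂ) (deriv G z)).re * W z + 2 * ((F z).re * (G z).re - ε))) S :=
      (hQW.add (hUYi.const_mul 2)).const_mul _
    have hSi : IntegrableOn (fun z => π / 4 * t ^ 2 *
        ((deriv F z * (starRingEnd ℂ) (deriv G z)).re * W z + 2 * ((F z).re * (G z).re - ε)) -
        π * L ^ 2 * t ^ 3 * W z) S :=
      hSi₀.sub (hWS.const_mul _)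
    have hle : ∫ z in ball (0 : ℂ) 1, (η z * (π * W z - π / 2 * t ^ 2) -
        W z * ∫ h in ball (0 : ℂ) 1, η (z + t * h)) ≤ ∫ z in ball (0 : ℂ) 1,
        -S.indicator (fun z => π / 4 * t ^ 2 *
        ((deriv F z * (starRingEnd ℂ) (deriv G z)).re * W z + 2 * ((F z).re * (G z).re - ε)) -
        π * L ^ 2 * t ^ 3 * W z) z := by
      refine integral_mono (hηW.sub hAi)
        ((integrable_indicator_iff hSo.measurableSet).2
          (hSi.mono_measure Measure.restrict_le_self)).neg fun z => ?_
      have h1 := mul_le_mul_of_nonneg_left (hlow z) (hW.nonneg z)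
      by_cases hz : z ∈ S
      · rw [hη, indicator_of_mem hz, indicator_of_mem hz] at h1
        simp only [indicator_of_mem hz]
        rw [show η z = (F z).re * (G z).re - ε from indicator_of_mem hz _]
        linarith
      · rw [hη, indicator_of_notMem hz, indicator_of_notMem hz] at h1
        simp only [indicator_of_notMem hz]
        rw [show η z = 0 from indicator_of_notMem hz _]
        linarith
    rw [integral_neg, setIntegral_indicator hSo.measurableSet, inter_eq_self_of_subset_right hS1,
      integral_sub hSi₀ (hWS.const_mul _),
      integral_const_mul, integral_const_mul] at hle
    have hpt : 0 < π / 4 * t ^ 2 := by positivity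
    refine le_of_mul_le_mul_left ?_ hpt
    linarith
  have hlim : Filter.Tendsto (fun t => (4 * L ^ 2 * ∫ z in S, W z) * t) (nhdsWithin 0 (Ioi 0))
      (nhds 0) := by
    have : Filter.Tendsto (fun t : ℝ => (4 * L ^ 2 * ∫ z in S, W z) * t) (nhds 0)
      (nhds ((4 * L ^ 2 * ∫ z in S, W z) * 0)) := (continuous_const.mul continuous_id).tendsto 0
    rw [mul_zero] at this
    exact this.mono_left nhdsWithin_le_nhds
  exact ge_of_tendsto hlim (Filter.mem_of_superset (Ioo_mem_nhdsGT (by linarith)) key)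

/-- The energy estimate for the approximate decompositions `f = F - (F - f)`. -/
lemma IsStrictWeight.energy_le {W : ℂ → ℝ} (hW : IsStrictWeight W) {F f : ℂ → ℂ}
    (hF : DifferentiableOn ℂ F (ball 0 1)) (hf : DifferentiableOn ℂ f (ball 0 1))
    (hfW : IntegrableOn (fun z => ‖deriv f z‖ ^ 2 * W z) (ball 0 1)) {r ε : ℝ}
    (hr0 : 0 < r) (hr1 : r < 1)
    (hs : ∀ z ∈ sphere (0 : ℂ) r, (F z).re * (F z - f z).re < ε) {S : Set ℂ}
    (hS : S = {z ∈ ball (0 : ℂ) r | ε < (F z).re * (F z - f z).re}) :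
    MeasurableSet S ∧ ∫⁻ z in S, ENNReal.ofReal (‖deriv F z‖ ^ 2 * W z) ≤
        ENNReal.ofReal (∫ z in ball (0 : ℂ) 1, ‖deriv f z‖ ^ 2 * W z) ∧
      IntegrableOn (fun z => (F z).re * (F z - f z).re - ε) S ∧
      ∫ z in S, ((F z).re * (F z - f z).re - ε) ≤
        1 / 4 * ∫ z in ball (0 : ℂ) 1, ‖deriv f z‖ ^ 2 * W z := by
  set D := ∫ z in ball (0 : ℂ) 1, ‖deriv f z‖ ^ 2 * W z
  have hG : DifferentiableOn ℂ (fun z => F z - f z) (ball 0 1) := hF.sub hf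
  obtain ⟨hSm, hQ, hI, hle⟩ := hW.setIntegral_le_zero hF hG hr0 hr1 hs hS
  have hS1 : S ⊆ closedBall 0 r := fun z hz => by rw [hS] at hz; exact ball_subset_closedBall hz.1
  have hrsub : closedBall (0 : ℂ) r ⊆ ball 0 1 := closedBall_subset_ball hr1
  have hbdd : ∀ {g : ℂ → ℂ}, DifferentiableOn ℂ g (ball 0 1) →
      IntegrableOn (fun z => ‖deriv g z‖ ^ 2 * W z) S := fun {g} hg => by
    have hc : ContinuousOn (fun z => ‖deriv g z‖ ^ 2) (ball 0 1) :=
      (hg.deriv isOpen_ball).continuousOn.norm.pow 2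
    obtain ⟨C, hC⟩ := (isCompact_closedBall (0 : ℂ) r).exists_bound_of_continuousOn
      (hc.mono hrsub)
    exact (hW.integrable.mono_set (hS1.trans hrsub)).bdd_mul
      ((hc.mono (hS1.trans hrsub)).aestronglyMeasurable hSm)
      ((ae_restrict_mem hSm).mono fun z hz => hC z (hS1 hz))
  have hFi := hbdd hF
  have hGi := hbdd hG
  have hfi := hbdd hf
  have hfD : ∫ z in S, ‖deriv f z‖ ^ 2 * W z ≤ D :=
    setIntegral_mono_set hfW (ae_of_all _ fun z => mul_nonneg (sq_nonneg _) (hW.nonneg z))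
      (hS1.trans hrsub).eventuallyLE
  have hQe : ∫ z in S, 2 * ((deriv F z * (starRingEnd ℂ) (deriv (fun z => F z - f z) z)).re * W z)
      = ∫ z in S, (‖deriv F z‖ ^ 2 * W z + ‖deriv (fun z => F z - f z) z‖ ^ 2 * W z -
        ‖deriv f z‖ ^ 2 * W z) := by
    refine setIntegral_congr_fun hSm fun z hz => ?_
    have hz1 := isOpen_ball.mem_nhds (hrsub (hS1 hz))
    have hd : deriv (fun z => F z - f z) z = deriv F z - deriv f z :=
      deriv_fun_sub (hF.differentiableAt hz1) (hf.differentiableAt hz1)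
    simp only [hd, ← Complex.normSq_eq_norm_sq, Complex.normSq_apply, Complex.mul_re,
      Complex.conj_re, Complex.conj_im, Complex.sub_re, Complex.sub_im]
    ring
  have hFG : IntegrableOn (fun z => ‖deriv F z‖ ^ 2 * W z +
      ‖deriv (fun z => F z - f z) z‖ ^ 2 * W z) S := hFi.add hGi
  rw [integral_sub hFG hfi, integral_const_mul, integral_add hFi hGi] at hQe
  rw [integral_add hQ (hI.const_mul 2), integral_const_mul] at hle
  have hFn : 0 ≤ ∫ z in S, ‖deriv F z‖ ^ 2 * W z :=
    integral_nonneg fun z => mul_nonneg (sq_nonneg _) (hW.nonneg z)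
  have hGn : 0 ≤ ∫ z in S, ‖deriv (fun z => F z - f z) z‖ ^ 2 * W z :=
    integral_nonneg fun z => mul_nonneg (sq_nonneg _) (hW.nonneg z)
  have hIn : 0 ≤ ∫ z in S, ((F z).re * (F z - f z).re - ε) :=
    setIntegral_nonneg hSm fun z hz => by rw [hS] at hz; exact sub_nonneg.2 hz.2.le
  refine ⟨hSm, ?_, hI, by linarith⟩
  rw [← ofReal_integral_eq_lintegral_ofReal hFi
    (ae_of_all _ fun z => mul_nonneg (sq_nonneg _) (hW.nonneg z))]
  exact ENNReal.ofReal_le_ofReal (by linarith)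

/-- Real parts of entire functions are uniformly dense in the continuous functions on a circle. -/
lemma exists_differentiable_abs_re_sub_le {u : ℂ → ℝ} {r δ : ℝ} (hr : 0 < r) (hδ : 0 < δ)
    (hu : ContinuousOn u (sphere 0 r)) :
    ∃ p : ℂ → ℂ, Differentiable ℂ p ∧ ∀ z ∈ sphere (0 : ℂ) r, |(p z).re - u z| ≤ δ := by
  have : Fact (0 < 2 * π) := ⟨Real.two_pi_pos⟩
  have hmem : ∀ x : AddCircle (2 * π), (r : ℂ) * AddCircle.toCircle x ∈ sphere (0 : ℂ) r :=
    fun x => by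
      rw [mem_sphere_zero_iff_norm, norm_mul, Circle.norm_coe, Complex.norm_real,
        Real.norm_of_nonneg hr.le, mul_one]
  have hc : Continuous fun x : AddCircle (2 * π) => (r : ℂ) * AddCircle.toCircle x :=
    continuous_const.mul (continuous_subtype_val.comp AddCircle.continuous_toCircle)
  let v : C(AddCircle (2 * π), ℂ) := ⟨fun x => (u (r * AddCircle.toCircle x) : ℂ),
    Complex.continuous_ofReal.comp (hu.comp_continuous hc hmem)⟩
  have hv : v ∈ closure (Submodule.span ℂ (range (@fourier (2 * π))) : Set _) := by
    rw [← Submodule.topologicalClosure_coe, span_fourier_closure_eq_top]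
    trivial
  obtain ⟨g, hg, hvg⟩ := Metric.mem_closure_iff.1 hv δ hδ
  have hspan : ∃ P Q : ℂ → ℂ, Differentiable ℂ P ∧ Differentiable ℂ Q ∧
      ∀ x, g x = P (r * AddCircle.toCircle x) + (starRingEnd ℂ) (Q (r * AddCircle.toCircle x)) := by
    have hpow : ∀ (n : ℕ) (x : AddCircle (2 * π)),
        fourier (n : ℤ) x = ((r : ℂ) * AddCircle.toCircle x / r) ^ n := fun n x => by
      rw [mul_div_cancel_left₀ _ (by exact_mod_cast hr.ne'), fourier_apply, natCast_zsmul,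
        AddCircle.toCircle_nsmul, Circle.coe_pow]
    clear hvg
    induction hg using Submodule.span_induction with
    | mem g hg =>
      obtain ⟨n, rfl⟩ := hg
      obtain ⟨k, rfl | rfl⟩ := n.eq_nat_or_neg
      · exact ⟨fun z => (z / r) ^ k, fun _ => 0, by fun_prop, by fun_prop, fun x => by
          rw [hpow]; simp⟩
      · exact ⟨fun _ => 0, fun z => (z / r) ^ k, by fun_prop, by fun_prop, fun x => by
          rw [fourier_neg, hpow, zero_add]⟩
    | zero => exact ⟨fun _ => 0, fun _ => 0, by fun_prop, by fun_prop, by simp⟩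
    | add g₁ g₂ _ _ h₁ h₂ =>
      obtain ⟨P₁, Q₁, hP₁, hQ₁, e₁⟩ := h₁
      obtain ⟨P₂, Q₂, hP₂, hQ₂, e₂⟩ := h₂
      refine ⟨fun z => P₁ z + P₂ z, fun z => Q₁ z + Q₂ z, by fun_prop, by fun_prop, fun x => ?_⟩
      rw [ContinuousMap.add_apply, e₁, e₂, map_add]
      ring
    | smul c g _ h =>
      obtain ⟨P, Q, hP, hQ, e⟩ := h
      refine ⟨fun z => c * P z, fun z => (starRingEnd ℂ) c * Q z, by fun_prop, by fun_prop,
        fun x => ?_⟩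
      rw [ContinuousMap.smul_apply, e, smul_eq_mul, map_mul, Complex.conj_conj]
      ring
  obtain ⟨P, Q, hP, hQ, e⟩ := hspan
  refine ⟨fun z => P z + Q z, by fun_prop, fun z hz => ?_⟩
  have hz' : (r : ℂ) * AddCircle.toCircle ((z.arg : ℝ) : AddCircle (2 * π)) = z := by
    rw [AddCircle.toCircle_apply_mk, div_self Real.two_pi_pos.ne', one_mul, Circle.coe_exp,
      ← mem_sphere_zero_iff_norm.1 hz, Complex.norm_mul_exp_arg_mul_I]
  have h1 := ContinuousMap.dist_apply_le_dist (f := v) (g := g) ((z.arg : ℝ) : AddCircle (2 * π))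
  rw [dist_comm, dist_eq_norm, e, show v ((z.arg : ℝ) : AddCircle (2 * π)) = (u z : ℂ) by
    simp only [v, ContinuousMap.coe_mk, hz'], hz'] at h1
  refine le_trans ?_ (h1.trans hvg.le)
  refine le_trans (le_of_eq ?_) (Complex.abs_re_le_norm _)
  simp

/-- The maximum principle for real parts of holomorphic functions. -/
lemma re_nonneg_of_sphere {H : ℂ → ℂ} {r : ℝ} (hr : 0 < r)
    (hH : DifferentiableOn ℂ H (closedBall 0 r)) (hs : ∀ z ∈ sphere (0 : ℂ) r, 0 ≤ (H z).re)
    {z : ℂ} (hz : z ∈ closedBall (0 : ℂ) r) : 0 ≤ (H z).re := by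
  have hd : DiffContOnCl ℂ (fun z => Complex.exp (-H z)) (ball 0 r) :=
    (hH.neg.cexp).diffContOnCl_ball subset_rfl
  have := Complex.norm_le_of_forall_mem_frontier_norm_le isBounded_ball hd (C := 1)
    (fun x hx => by
      rw [frontier_ball _ hr.ne'] at hx
      rw [Complex.norm_exp, Complex.neg_re, Real.exp_le_one_iff]
      linarith [hs x hx]) (by rwa [closure_ball _ hr.ne'])
  rw [Complex.norm_exp, Complex.neg_re, Real.exp_le_one_iff] at this
  linarith

/-- The strong maximum principle for real parts of holomorphic functions. -/
lemma deriv_eq_zero_of_re_nonneg {H : ℂ → ℂ} (hH : DifferentiableOn ℂ H (ball 0 1))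
    (h0 : ∀ z ∈ ball (0 : ℂ) 1, 0 ≤ (H z).re) {c : ℂ} (hc : c ∈ ball (0 : ℂ) 1)
    (hHc : (H c).re = 0) : ∀ z ∈ ball (0 : ℂ) 1, deriv H z = 0 := by
  have hd : DifferentiableOn ℂ (fun z => Complex.exp (-H z)) (ball 0 1) := hH.neg.cexp
  have heq := Complex.eqOn_of_isPreconnected_of_isMaxOn_norm
    (convex_ball (0 : ℂ) 1).isPreconnected isOpen_ball hd hc (fun z hz => by
      simp only [mem_ofPred_eq, Function.comp_apply, Complex.norm_exp, Complex.neg_re, hHc]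
      exact Real.exp_le_exp.2 (neg_le_neg (h0 z hz)))
  intro z hz
  have hz1 := isOpen_ball.mem_nhds hz
  have h1 : HasDerivAt (fun z => Complex.exp (-H z)) (Complex.exp (-H z) * -deriv H z) z :=
    ((hH.differentiableAt hz1).hasDerivAt.neg).cexp
  have h2 : HasDerivAt (fun z => Complex.exp (-H z)) 0 z :=
    (hasDerivAt_const z (Complex.exp (-H c))).congr_of_eventuallyEq
      (Filter.eventually_of_mem hz1 heq)
  simpa using h1.unique h2

/-- On a smaller disk, a holomorphic function is almost a difference of two holomorphic functions
whose real parts are nonnegative and have a small product on the boundary. -/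
lemma exists_approx_decomposition {f : ℂ → ℂ} (hf : DifferentiableOn ℂ f (ball 0 1)) {r ε : ℝ}
    (hr0 : 0 < r) (hr1 : r < 1) (hε : 0 < ε) :
    ∃ F : ℂ → ℂ, Differentiable ℂ F ∧ (F 0).im = 0 ∧
      (∀ z ∈ closedBall (0 : ℂ) r, 0 ≤ (F z).re ∧ 0 ≤ (F z - f z).re) ∧
      ∀ z ∈ sphere (0 : ℂ) r, (F z).re * (F z - f z).re < ε := by
  have hrsub : closedBall (0 : ℂ) r ⊆ ball 0 1 := closedBall_subset_ball hr1
  have hssub : sphere (0 : ℂ) r ⊆ closedBall 0 r := sphere_subset_closedBall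
  have hu : ContinuousOn (fun z => (f z).re) (sphere 0 r) :=
    Complex.continuous_re.comp_continuousOn (hf.continuousOn.mono (hssub.trans hrsub))
  obtain ⟨M, hM⟩ := (isCompact_sphere (0 : ℂ) r).exists_bound_of_continuousOn hu
  have hM0 : 0 ≤ M := (norm_nonneg _).trans (hM r (by simp [hr0.le]))
  set δ := min 1 (ε / (4 * (M + 2)))
  have hδ : 0 < δ := lt_min one_pos (by positivity)
  have hδ1 : δ ≤ 1 := min_le_left _ _
  have hδε : δ * (4 * (M + 2)) ≤ ε := (le_div_iff₀ (by positivity)).1 (min_le_right _ _)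
  obtain ⟨p, hp, hpu⟩ := exists_differentiable_abs_re_sub_le hr0 hδ
    (continuousOn_const.sup hu : ContinuousOn (fun z => max 0 (f z).re) (sphere 0 r))
  have hFre : ∀ z, (p z + δ - ((p 0).im : ℂ) * I).re = (p z).re + δ := fun z => by simp
  have hsph : ∀ z ∈ sphere (0 : ℂ) r, max 0 (f z).re ≤ (p z).re + δ ∧
      (p z).re + δ ≤ max 0 (f z).re + 2 * δ := fun z hz => by
    have := abs_le.1 (hpu z hz)
    constructor <;> linarith
  refine ⟨fun z => p z + δ - ((p 0).im : ℂ) * I, by fun_prop, by simp, fun z hz => ⟨?_, ?_⟩,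
    fun z hz => ?_⟩
  · refine re_nonneg_of_sphere (H := fun z => p z + δ - ((p 0).im : ℂ) * I) hr0 (by fun_prop)
      (fun z hz => ?_) hz
    rw [hFre]
    exact (le_max_left _ _).trans (hsph z hz).1
  · refine re_nonneg_of_sphere (H := fun z => p z + δ - ((p 0).im : ℂ) * I - f z) hr0 ?_
      (fun z hz => ?_) hz
    · exact DifferentiableOn.sub (by fun_prop) (hf.mono hrsub)
    · rw [Complex.sub_re, hFre]
      linarith [(le_max_right _ _).trans (hsph z hz).1]
  · simp only [Complex.sub_re (_ - _) (f z), hFre]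
    obtain ⟨h1, h2⟩ := hsph z hz
    have h3 := abs_le.1 (hM z hz)
    rcases le_total 0 (f z).re with h | h
    · rw [max_eq_right h] at h1 h2
      have := mul_le_mul (show (p z).re + δ ≤ M + 2 by linarith)
        (show (p z).re + δ - (f z).re ≤ 2 * δ by linarith) (by linarith) (by linarith)
      nlinarith
    · rw [max_eq_left h] at h1 h2
      have := mul_le_mul (show (p z).re + δ ≤ 2 * δ by linarith)
        (show (p z).re + δ - (f z).re ≤ M + 2 by linarith) (by linarith) (by linarith)
      nlinarith

/-- A Montel theorem for sequences of entire functions which are eventually uniformly bounded on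
each circle of radius less than one. -/
lemma exists_subseq_tendstoLocallyUniformlyOn {F : ℕ → ℂ → ℂ} (hF : ∀ n, Differentiable ℂ (F n))
    (hb : ∀ s : ℝ, 0 < s → s < 1 → ∃ B, ∀ᶠ n in Filter.atTop, ∀ z ∈ sphere (0 : ℂ) s,
      ‖F n z‖ ≤ B) :
    ∃ φ : ℕ → ℕ, StrictMono φ ∧ ∃ G : ℂ → ℂ,
      TendstoLocallyUniformlyOn (fun n => F (φ n)) G Filter.atTop (ball 0 1) := by
  let a : ℕ → ℕ → ℂ := fun n k => (k.factorial : ℂ)⁻¹ * iteratedDeriv k (F n) 0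
  have hsum : ∀ n z, HasSum (fun k => a n k * z ^ k) (F n z) := fun n z => by
    have h := Complex.hasSum_taylorSeries_of_entire (hF n) 0 z
    simp only [sub_zero, smul_eq_mul] at h
    refine h.congr_fun fun k => ?_
    simp only [a]
    ring
  have ha : ∀ s : ℝ, 0 < s → s < 1 → ∃ B, ∀ᶠ n in Filter.atTop, ∀ k, ‖a n k‖ ≤ B / s ^ k := by
    intro s hs hs1
    obtain ⟨B, hB⟩ := hb s hs hs1
    refine ⟨B, hB.mono fun n hn k => ?_⟩
    have h := Complex.norm_iteratedDeriv_le_of_forall_mem_sphere_norm_le k hs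
      (hF n).diffContOnCl hn
    have hk : (0 : ℝ) < k.factorial := by exact_mod_cast k.factorial_pos
    rw [norm_mul, norm_inv, Complex.norm_natCast, inv_mul_le_iff₀ hk, ← mul_div_assoc]
    exact h
  obtain ⟨B₀, hB₀⟩ := ha (1 / 2) (by norm_num) (by norm_num)
  obtain ⟨b, -, φ, hφ, hlim⟩ := (isCompact_univ_pi fun k : ℕ =>
    isCompact_closedBall (0 : ℂ) (B₀ / (1 / 2) ^ k)).tendsto_subseq' (x := a)
    (hB₀.mono fun n hn k _ => by simpa using hn k).frequently
  have hlim' : ∀ k, Filter.Tendsto (fun n => a (φ n) k) Filter.atTop (nhds (b k)) :=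
    fun k => (tendsto_pi_nhds.1 hlim) k
  refine ⟨φ, hφ, fun z => ∑' k, b k * z ^ k, ?_⟩
  rw [tendstoLocallyUniformlyOn_iff_forall_isCompact isOpen_ball]
  intro K hK hKc
  obtain ⟨s, hs0, hs1, hKs⟩ : ∃ s : ℝ, 0 ≤ s ∧ s < 1 ∧ ∀ z ∈ K, ‖z‖ ≤ s := by
    rcases K.eq_empty_or_nonempty with rfl | hne
    · exact ⟨0, le_rfl, one_pos, by simp⟩
    · obtain ⟨x, hx, hmax⟩ := hKc.exists_isMaxOn hne continuous_norm.continuousOn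
      exact ⟨‖x‖, norm_nonneg _, by simpa using hK hx, fun z hz => hmax hz⟩
  obtain ⟨t, hst, ht1⟩ := exists_between hs1
  have ht0 : 0 < t := hs0.trans_lt hst
  obtain ⟨B, hB⟩ := ha t ht0 ht1
  have hBφ : ∀ᶠ n in Filter.atTop, ∀ k, ‖a (φ n) k‖ ≤ B / t ^ k := hφ.tendsto_atTop.eventually hB
  have hbB : ∀ k, ‖b k‖ ≤ B / t ^ k := fun k =>
    le_of_tendsto (hlim' k).norm (hBφ.mono fun n hn => hn k)
  have hgeom : Summable fun k : ℕ => 2 * B * (s / t) ^ k :=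
    (summable_geometric_of_lt_one (by positivity) ((div_lt_one ht0).2 hst)).mul_left _
  have hdiff : ∀ᶠ n in Filter.atTop, ∀ k, ‖a (φ n) k - b k‖ * s ^ k ≤ 2 * B * (s / t) ^ k :=
    hBφ.mono fun n hn k => by
      calc ‖a (φ n) k - b k‖ * s ^ k ≤ (B / t ^ k + B / t ^ k) * s ^ k := by
            gcongr
            exact (norm_sub_le _ _).trans (add_le_add (hn k) (hbB k))
        _ = 2 * B * (s / t) ^ k := by rw [div_pow]; ring
  have hzero : Filter.Tendsto (fun n => ∑' k, ‖a (φ n) k - b k‖ * s ^ k) Filter.atTop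
      (nhds (∑' _ : ℕ, (0 : ℝ))) := by
    refine tendsto_tsum_of_dominated_convergence hgeom (fun k => ?_) (hdiff.mono fun n hn k => ?_)
    · have := ((hlim' k).sub_const (b k)).norm.mul_const (s ^ k)
      simpa using this
    · rw [Real.norm_of_nonneg (by positivity)]
      exact hn k
  rw [tsum_zero] at hzero
  rw [Metric.tendstoUniformlyOn_iff]
  intro ε hε
  filter_upwards [hdiff, hzero.eventually_lt_const hε] with n hn hnε z hz
  have hzs := hKs z hz
  have hterm : ∀ k, ‖(a (φ n) k - b k) * z ^ k‖ ≤ ‖a (φ n) k - b k‖ * s ^ k := fun k => by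
    rw [norm_mul, norm_pow]
    gcongr
  have hsumm : Summable fun k => ‖a (φ n) k - b k‖ * s ^ k :=
    hgeom.of_nonneg_of_le (fun k => by positivity) hn
  have hsub : Summable fun k => (a (φ n) k - b k) * z ^ k := hsumm.of_norm_bounded hterm
  have hbs : Summable fun k => b k * z ^ k := by
    refine ((hsum (φ n) z).summable.sub hsub).congr fun k => ?_
    ring
  have heq : F (φ n) z - ∑' k, b k * z ^ k = ∑' k, (a (φ n) k - b k) * z ^ k := by
    rw [← (hsum (φ n) z).tsum_eq, ← (hsum (φ n) z).summable.tsum_sub hbs]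
    exact tsum_congr fun k => by ring
  rw [dist_comm, dist_eq_norm, heq]
  exact (tsum_of_norm_bounded hsumm.hasSum hterm).trans_lt hnε

/-- Holomorphic functions with nonnegative real part are bounded on smaller disks in terms of
their value at the origin. -/
lemma norm_le_of_re_nonneg {F : ℂ → ℂ} {R C : ℝ} (hF : DifferentiableOn ℂ F (ball 0 R))
    (h0 : ∀ z ∈ ball (0 : ℂ) R, 0 ≤ (F z).re) (hC : ‖F 0‖ ≤ C) {z : ℂ} (hz : ‖z‖ < R) :
    ‖F z‖ ≤ 2 * ‖z‖ / (R - ‖z‖) + C * (R + ‖z‖) / (R - ‖z‖) := by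
  have hR : 0 < R := (norm_nonneg z).trans_lt hz
  have h := Complex.borelCaratheodory one_pos hF.neg (fun x hx => by
    simp only [mem_ofPred_eq, Pi.neg_apply, Complex.neg_re]
    linarith [h0 x hx]) hR (mem_ball_zero_iff.2 hz)
  simp only [Pi.neg_apply, norm_neg, mul_one] at h
  refine h.trans ?_
  have : 0 < R - ‖z‖ := sub_pos.2 hz
  gcongr

/-- Bound at the origin for the approximate decompositions. -/
lemma re_zero_le_of_setIntegral_le {F f : ℂ → ℂ} (hF : Differentiable ℂ F) {r ε D M : ℝ}
    (hr : 1 / 2 ≤ r) (h0 : ∀ z ∈ closedBall (0 : ℂ) r, 0 ≤ (F z).re) (hε : ε ≤ 1)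
    (hM : ∀ z ∈ closedBall (0 : ℂ) (1 / 4), |(f z).re| ≤ M) {S : Set ℂ}
    (hS : S = {z ∈ ball (0 : ℂ) r | ε < (F z).re * (F z - f z).re}) (hSm : MeasurableSet S)
    (hI : IntegrableOn (fun z => (F z).re * (F z - f z).re - ε) S)
    (hD : ∫ z in S, ((F z).re * (F z - f z).re - ε) ≤ 1 / 4 * D) :
    (F 0).re ≤ 4 * D / π + (1 + (1 + M) ^ 2 / 4) := by
  set g : ℂ → ℝ := S.indicator fun z => (F z).re * (F z - f z).re - ε with hg
  have hg0 : ∀ z, 0 ≤ g z := indicator_nonneg fun z hz => by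
    rw [hS] at hz
    exact sub_nonneg.2 hz.2.le
  have hgi : Integrable g := (integrable_indicator_iff hSm).2 hI
  have hgint : ∫ z, g z ≤ 1 / 4 * D := by rwa [integral_indicator hSm]
  have hgs : Integrable fun h => g (0 + ((1 / 4 : ℝ) : ℂ) * h) := by
    have := hgi.comp_smul (R := (1 / 4 : ℝ)) (by norm_num)
    simpa only [zero_add, ← Complex.real_smul] using this
  have hgse : ∫ h, g (0 + ((1 / 4 : ℝ) : ℂ) * h) = 16 * ∫ z, g z := by
    have := Measure.integral_comp_smul (volume : Measure ℂ) g (1 / 4 : ℝ)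
    simp only [zero_add, ← Complex.real_smul]
    rw [this, Complex.finrank_real_complex, smul_eq_mul]
    norm_num
  obtain ⟨hFi, hFe⟩ := integral_ball_re_of_differentiableOn (z := 0) (t := 1 / 4) (by norm_num)
    hF.differentiableOn
  have hle : ∫ h in ball (0 : ℂ) 1, (F (0 + ((1 / 4 : ℝ) : ℂ) * h)).re ≤ ∫ h in ball (0 : ℂ) 1,
      (g (0 + ((1 / 4 : ℝ) : ℂ) * h) + (1 + (1 + M) ^ 2 / 4)) := by
    refine setIntegral_mono_on hFi (hgs.integrableOn.add (integrableOn_ball_const _))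
      measurableSet_ball fun h hh => ?_
    have hx := add_mul_mem_closedBall (z := 0) (t := 1 / 4) (by norm_num) hh
    set x := 0 + ((1 / 4 : ℝ) : ℂ) * h
    have hxr : x ∈ ball (0 : ℂ) r := closedBall_subset_ball (by linarith) hx
    have hF0 := h0 x (ball_subset_closedBall hxr)
    have hMx := abs_le.1 (hM x hx)
    have hprod : (F x).re - (1 + M) ^ 2 / 4 ≤ (F x).re * (F x - f x).re := by
      rw [Complex.sub_re]
      nlinarith [sq_nonneg ((F x).re - (1 + M) / 2), mul_le_mul_of_nonneg_left hMx.2 hF0]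
    have hgx : (F x).re * (F x - f x).re - ε ≤ g x := by
      by_cases hxS : x ∈ S
      · rw [hg, indicator_of_mem hxS]
      · rw [hg, indicator_of_notMem hxS]
        rw [hS] at hxS
        exact sub_nonpos.2 (not_lt.1 fun h' => hxS ⟨hxr, h'⟩)
    linarith
  have hconst : ∫ _ in ball (0 : ℂ) 1, (1 + (1 + M) ^ 2 / 4) = π * (1 + (1 + M) ^ 2 / 4) := by
    simp [Measure.real, Complex.volume_ball]
  rw [hFe, integral_add hgs.integrableOn (integrableOn_ball_const _), hconst] at hle
  have hset : ∫ h in ball (0 : ℂ) 1, g (0 + ((1 / 4 : ℝ) : ℂ) * h) ≤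
      ∫ h, g (0 + ((1 / 4 : ℝ) : ℂ) * h) :=
    setIntegral_le_integral hgs (ae_of_all _ fun h => hg0 _)
  rw [hgse] at hset
  refine le_of_mul_le_mul_left ?_ Real.pi_pos
  rw [mul_add, mul_div_cancel₀ _ Real.pi_pos.ne']
  linarith

/-- Every function with finite weighted energy is a difference of functions with finite weighted
energy and nonnegative real part. -/
lemma IsStrictWeight.exists_decomposition {W : ℂ → ℝ} (hW : IsStrictWeight W) {f : ℂ → ℂ}
    (hf : MemDirichletW W f) :
    ∃ F, MemDirichletW W F ∧ (∀ z ∈ ball (0 : ℂ) 1, 0 ≤ (F z).re) ∧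
      ∀ z ∈ ball (0 : ℂ) 1, 0 ≤ (F z - f z).re := by
  obtain ⟨hfd, hfW⟩ := hf
  set D := ∫ z in ball (0 : ℂ) 1, ‖deriv f z‖ ^ 2 * W z with hD
  have hD0 : 0 ≤ D := integral_nonneg fun z => mul_nonneg (sq_nonneg _) (hW.nonneg z)
  let r : ℕ → ℝ := fun n => 1 - 1 / (n + 1 : ℝ) / 2
  let ε : ℕ → ℝ := fun n => 1 / (n + 1 : ℝ)
  have hε0 : ∀ n, 0 < ε n := fun n => by positivity
  have hε1 : ∀ n, ε n ≤ 1 := fun n => (div_le_one (by positivity)).2 (by simp)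
  have hεlim : Filter.Tendsto ε Filter.atTop (nhds 0) := tendsto_one_div_add_atTop_nhds_zero_nat
  have hr2 : ∀ n, 1 / 2 ≤ r n := fun n => by
    simp only [r]
    linarith [hε1 n]
  have hr1 : ∀ n, r n < 1 := fun n => by
    simp only [r]
    linarith [hε0 n]
  have hrlim : Filter.Tendsto r Filter.atTop (nhds 1) := by
    simpa using (hεlim.div_const 2).const_sub 1
  have hr0 : ∀ n, 0 < r n := fun n => by linarith [hr2 n]
  choose F hF hFim hFpos hFs using fun n => exists_approx_decomposition hfd (hr0 n) (hr1 n) (hε0 n)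
  let S : ℕ → Set ℂ := fun n => {z ∈ ball (0 : ℂ) (r n) | ε n < (F n z).re * (F n z - f z).re}
  have hen := fun n => hW.energy_le (hF n).differentiableOn hfd hfW (hr0 n) (hr1 n) (hFs n)
    (S := S n) rfl
  obtain ⟨M, hM⟩ := (isCompact_closedBall (0 : ℂ) (1 / 4)).exists_bound_of_continuousOn
    (Complex.continuous_re.comp_continuousOn
      (hfd.continuousOn.mono (closedBall_subset_ball (by norm_num))))
  set C := 4 * D / π + (1 + (1 + M) ^ 2 / 4)
  have hC : ∀ n, ‖F n 0‖ ≤ C := fun n => by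
    obtain ⟨hSm, -, hI, hle⟩ := hen n
    have h1 := re_zero_le_of_setIntegral_le (hF n) (hr2 n) (fun z hz => (hFpos n z hz).1) (hε1 n)
      hM rfl hSm hI hle
    have h2 := (hFpos n 0 (mem_closedBall_self (hr0 n).le)).1
    rwa [← (F n 0).re_add_im, hFim, Complex.ofReal_zero, zero_mul, add_zero, Complex.norm_real,
      Real.norm_of_nonneg h2]
  obtain ⟨φ, hφ, G, hG⟩ := exists_subseq_tendstoLocallyUniformlyOn hF fun s hs hs1 => by
    obtain ⟨R, hsR, hR1⟩ := exists_between hs1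
    refine ⟨2 * s / (R - s) + C * (R + s) / (R - s), ?_⟩
    filter_upwards [hrlim.eventually_const_lt hR1] with n hn z hz
    have hzs : ‖z‖ = s := by simpa using hz
    have := norm_le_of_re_nonneg (R := R) (hF n).differentiableOn (fun x hx =>
      (hFpos n x (closedBall_subset_closedBall hn.le (ball_subset_closedBall hx))).1) (hC n)
      (z := z) (hzs.trans_lt hsR)
    rwa [hzs] at this
  have hFd : ∀ᶠ n in Filter.atTop, DifferentiableOn ℂ (F (φ n)) (ball 0 1) :=
    Filter.Eventually.of_forall fun n => (hF _).differentiableOn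
  have hGd := hG.differentiableOn hFd isOpen_ball
  have hGt : ∀ z ∈ ball (0 : ℂ) 1, Filter.Tendsto (fun n => F (φ n) z) Filter.atTop (nhds (G z)) :=
    fun z hz => hG.tendsto_at hz
  have hGt' : ∀ z ∈ ball (0 : ℂ) 1,
      Filter.Tendsto (fun n => deriv (F (φ n)) z) Filter.atTop (nhds (deriv G z)) :=
    fun z hz => (hG.deriv hFd isOpen_ball).tendsto_at hz
  have hrφ : ∀ z ∈ ball (0 : ℂ) 1, ∀ᶠ n in Filter.atTop, z ∈ ball (0 : ℂ) (r (φ n)) := fun z hz =>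
    ((hrlim.comp hφ.tendsto_atTop).eventually_const_lt (mem_ball_zero_iff.1 hz)).mono
      fun n hn => mem_ball_zero_iff.2 hn
  have hre : ∀ z ∈ ball (0 : ℂ) 1,
      Filter.Tendsto (fun n => (F (φ n) z).re) Filter.atTop (nhds (G z).re) := fun z hz =>
    (Complex.continuous_re.tendsto _).comp (hGt z hz)
  have hre' : ∀ z ∈ ball (0 : ℂ) 1,
      Filter.Tendsto (fun n => (F (φ n) z - f z).re) Filter.atTop (nhds (G z - f z).re) :=
    fun z hz => (Complex.continuous_re.tendsto _).comp ((hGt z hz).sub_const _)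
  have hG0 : ∀ z ∈ ball (0 : ℂ) 1, 0 ≤ (G z).re := fun z hz =>
    ge_of_tendsto (hre z hz) ((hrφ z hz).mono fun n hn =>
      (hFpos _ z (ball_subset_closedBall hn)).1)
  have hG0' : ∀ z ∈ ball (0 : ℂ) 1, 0 ≤ (G z - f z).re := fun z hz =>
    ge_of_tendsto (hre' z hz) ((hrφ z hz).mono fun n hn =>
      (hFpos _ z (ball_subset_closedBall hn)).2)
  refine ⟨G, ⟨hGd, ?_⟩, hG0, hG0'⟩
  by_cases hz1 : ∃ c ∈ ball (0 : ℂ) 1, (G c).re = 0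
  · obtain ⟨c, hc, hGc⟩ := hz1
    have hzero : IntegrableOn (fun _ : ℂ => (0 : ℝ)) (ball 0 1) := integrableOn_ball_const 0
    refine hzero.congr_fun (fun z hz => ?_) measurableSet_ball
    simp [deriv_eq_zero_of_re_nonneg hGd hG0 hc hGc z hz]
  by_cases hz2 : ∃ c ∈ ball (0 : ℂ) 1, (G c - f c).re = 0
  · obtain ⟨c, hc, hGc⟩ := hz2
    refine hfW.congr_fun (fun z hz => ?_) measurableSet_ball
    have hz' := isOpen_ball.mem_nhds hz
    have := deriv_eq_zero_of_re_nonneg (hGd.sub hfd) hG0' hc hGc z hz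
    rw [deriv_sub (hGd.differentiableAt hz') (hfd.differentiableAt hz'), sub_eq_zero] at this
    simp only [this]
  push Not at hz1 hz2
  refine (integrableOn_and_integral_le_of_lintegral_le (C := D)
    (((measurable_deriv G).norm.pow_const 2).mul hW.measurable)
    (fun z => mul_nonneg (sq_nonneg _) (hW.nonneg z)) hD0 ?_).1
  let ψ : ℕ → ℂ → ℝ≥0∞ := fun n => (S (φ n)).indicator fun z =>
    ENNReal.ofReal (‖deriv (F (φ n)) z‖ ^ 2 * W z)
  calc ∫⁻ z in ball (0 : ℂ) 1, ENNReal.ofReal (‖deriv G z‖ ^ 2 * W z)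
      ≤ ∫⁻ z in ball (0 : ℂ) 1, Filter.liminf (fun n => ψ n z) Filter.atTop := by
        refine setLIntegral_mono' measurableSet_ball fun z hz => le_of_eq ?_
        refine (Filter.Tendsto.liminf_eq ?_).symm
        have hpos : 0 < (G z).re * (G z - f z).re :=
          mul_pos (lt_of_le_of_ne (hG0 z hz) (hz1 z hz).symm)
            (lt_of_le_of_ne (hG0' z hz) (hz2 z hz).symm)
        have hlt := (hεlim.comp hφ.tendsto_atTop).eventually_lt ((hre z hz).mul (hre' z hz)) hpos
        refine (ENNReal.tendsto_ofReal (((hGt' z hz).norm.pow 2).mul_const (W z))).congr' ?_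
        filter_upwards [hlt, hrφ z hz] with n hn1 hn2
        exact (indicator_of_mem (show z ∈ S (φ n) from ⟨hn2, hn1⟩) (fun z =>
          ENNReal.ofReal (‖deriv (F (φ n)) z‖ ^ 2 * W z))).symm
    _ ≤ Filter.liminf (fun n => ∫⁻ z in ball (0 : ℂ) 1, ψ n z) Filter.atTop :=
        lintegral_liminf_le fun n => (((measurable_deriv _).norm.pow_const 2).mul
          hW.measurable).ennreal_ofReal.indicator (hen _).1
    _ ≤ ENNReal.ofReal D := by
        refine Filter.liminf_le_of_frequently_le' (Filter.Frequently.of_forall fun n => ?_)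
        refine (setLIntegral_le_lintegral _ _).trans ?_
        rw [lintegral_indicator (hen _).1]
        exact (hen _).2.1

/-- Comparable weights define comparable weighted Dirichlet spaces. -/
lemma MemDirichletW.of_le {w W : ℂ → ℝ} {f : ℂ → ℂ} {C : ℝ} (hf : MemDirichletW w f)
    (hW : AEStronglyMeasurable W (volume.restrict (ball 0 1)))
    (hW0 : ∀ z ∈ ball (0 : ℂ) 1, 0 ≤ W z) (hC : ∀ z ∈ ball (0 : ℂ) 1, W z ≤ C * w z) :
    MemDirichletW W f := by
  refine ⟨hf.1, (hf.2.const_mul C).mono' ?_ ?_⟩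
  · exact ((measurable_deriv f).norm.pow_const 2).aestronglyMeasurable.mul hW
  · filter_upwards [ae_restrict_mem measurableSet_ball] with z hz
    rw [Real.norm_of_nonneg (mul_nonneg (sq_nonneg _) (hW0 z hz))]
    calc ‖deriv f z‖ ^ 2 * W z ≤ ‖deriv f z‖ ^ 2 * (C * w z) := by
          gcongr
          exact hC z hz
      _ = C * (‖deriv f z‖ ^ 2 * w z) := by ring

/-- Gleason–Kahane–Żelazko theorem for weighted Dirichlet spaces with
superharmonic weights: a linear functional `Λ` on `𝒟_w` (no continuity assumed)
with `Λ(1) = 1` that is non-zero on all nowhere-vanishing functions must be a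
point evaluation at some `a ∈ 𝔻`. -/
theorem weighted_dirichlet_GKZ (w : ℂ → ℝ)
    (hwpos : ∀ z ∈ Metric.ball (0 : ℂ) 1, 0 < w z)
    (hwsh : SuperharmonicOnDisk w)
    (Λ : (ℂ → ℂ) → ℂ)
    (hadd : ∀ f g, MemDirichletW w f → MemDirichletW w g → Λ (f + g) = Λ f + Λ g)
    (hsmul : ∀ (c : ℂ) (f), MemDirichletW w f → Λ (c • f) = c * Λ f)
    (hcong : ∀ f g, MemDirichletW w f → MemDirichletW w g →
      Set.EqOn f g (Metric.ball 0 1) → Λ f = Λ g)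
    (hone : Λ 1 = 1)
    (hnv : ∀ g, MemDirichletW w g → (∀ z ∈ Metric.ball (0 : ℂ) 1, g z ≠ 0) → Λ g ≠ 0) :
    ∃ a ∈ Metric.ball (0 : ℂ) 1, ∀ f, MemDirichletW w f → Λ f = f a := by
  have hΛ : IsNonvanishingFunctional w Λ := ⟨hadd, hsmul, hcong, hone, hnv⟩
  by_cases hne : ∃ f, MemDirichletW w f ∧ ∃ z ∈ ball (0 : ℂ) 1, deriv f z ≠ 0
  · obtain ⟨f₀, hf₀, hf₀ne⟩ := hne
    obtain ⟨hwi, W, hW, C, hC⟩ := exists_isStrictWeight hwpos hwsh hf₀ hf₀ne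
    refine hΛ.exists_eval_of_decomposition hwpos hwi fun f hf => ?_
    obtain ⟨F, hF, hF0, hG0⟩ := hW.exists_decomposition (hf.of_le
      hW.measurable.aestronglyMeasurable (fun z _ => hW.nonneg z) fun z hz => (hC z hz).2)
    have hFw : MemDirichletW w F := hF.of_le (C := 1) hwi.aestronglyMeasurable
      (fun z hz => (hwpos z hz).le) fun z hz => by
        rw [one_mul]
        exact (hC z hz).1
    have hneg : MemDirichletW w fun z => F z - f z := by
      have := hFw.add hwpos hwi (hf.const_smul hwpos hwi (-1))
      convert this using 1
      ext z
      simp [sub_eq_add_neg]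
    exact ⟨F, fun z => F z - f z, hFw, hneg, hF0, hG0, fun z _ => by ring⟩
  · push Not at hne
    refine ⟨0, mem_ball_self one_pos, fun f hf => ?_⟩
    have heq : EqOn f (fun _ => f 0) (ball 0 1) := fun z hz =>
      isOpen_ball.is_const_of_deriv_eq_zero (convex_ball (0 : ℂ) 1).isPreconnected hf.1
        (fun x hx => hne f hf x hx) hz (mem_ball_self one_pos)
    rw [hcong f _ hf (MemDirichletW.const _) heq, hΛ.map_const]
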